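/- Assume λ, μ ≥ 0 with μ > 0, and λ ≥ δ > −1. Set a = λ + μ + δ and b = λ + μ − 1. Then there exists a constant c > 0 such that for all integers n ≥ 2: ∫_0^1 |∫_{−1}^1 P_n^{(a+1/2, b+1/2)}(ty)(1−t²)^{μ−1} dt| · |y|^{2μ}(1−y²)^{λ−1/2} dy ≥ c n^{−μ−1/2} · L_n, where L_n = log n if δ = λ and L_n = 1 if −1 < δ < λ. -/

import Mathlib

open MeasureTheory Finset Real intervalIntegral

/-- Generalized binomial coefficient `C(x, k) = x (x-1) ⋯ (x-k+1) / k!`. -/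
noncomputable def genBinom (x : ℝ) (k : ℕ) : ℝ :=
  (∏ i ∈ Finset.range k, (x - i)) / (Nat.factorial k)

/-- Jacobi polynomial `P_n^{(a,b)}(t)`. -/
noncomputable def jacobiP (n : ℕ) (a b t : ℝ) : ℝ :=
  ∑ m ∈ Finset.range (n + 1),
    genBinom (n + a) (n - m) * genBinom (n + b) m * ((t - 1) / 2) ^ m * ((t + 1) / 2) ^ (n - m)

section JacobiPolynomial

open Polynomial

/-- Taylor coefficients at `0` of the hypergeometric polynomial `₂F₁(-n, n+a+b+1; a+1; z)`. -/
noncomputable def hypCoeff (n : ℕ) (a b : ℝ) : ℕ → ℝ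
  | 0 => 1
  | k + 1 => hypCoeff n a b k * (((k : ℝ) - n) * (k + n + a + b + 1) / ((k + a + 1) * (k + 1)))

/-- The Jacobi polynomial normalized at `1`, in the variable `z = (1 - x) / 2`. -/
noncomputable def jac (n : ℕ) (a b : ℝ) : ℝ[X] :=
  ∑ k ∈ Finset.range (n + 1), monomial k (hypCoeff n a b k)

lemma hypCoeff_eq_zero (n : ℕ) (a b : ℝ) {k : ℕ} (hk : n < k) : hypCoeff n a b k = 0 := by
  induction k, hk using Nat.le_induction with
  | base => simp [hypCoeff]
  | succ k _ ih => simp [hypCoeff, ih]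

lemma coeff_jac (n : ℕ) (a b : ℝ) (k : ℕ) : (jac n a b).coeff k = hypCoeff n a b k := by
  simp only [jac, finsetSum_coeff, coeff_monomial]
  rw [Finset.sum_ite_eq' ]
  split_ifs with h
  · rfl
  · exact (hypCoeff_eq_zero n a b (by simpa using h)).symm

lemma jac_zero (a b : ℝ) : jac 0 a b = 1 := by
  simp [jac, hypCoeff]

lemma natDegree_jac_le (n : ℕ) (a b : ℝ) : (jac n a b).natDegree ≤ n := by
  rw [natDegree_le_iff_coeff_eq_zero]
  intro k hk
  rw [coeff_jac, hypCoeff_eq_zero n a b hk]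

/-- The hypergeometric differential operator annihilating `jac n a b`. -/
noncomputable def hypOp (n : ℕ) (a b : ℝ) (f : ℝ[X]) : ℝ[X] :=
  X * (1 - X) * derivative (derivative f) + (C (a + 1) - C (a + b + 2) * X) * derivative f +
    C (n * (n + a + b + 1)) * f

lemma coeff_hypOp (n : ℕ) (a b : ℝ) (f : ℝ[X]) (k : ℕ) :
    (hypOp n a b f).coeff k =
      (k + 1) * (k + a + 1) * f.coeff (k + 1) - (k - n) * (k + n + a + b + 1) * f.coeff k := by
  have : hypOp n a b f = X * derivative (derivative f) - X * (X * derivative (derivative f)) +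
      C (a + 1) * derivative f - C (a + b + 2) * (X * derivative f) +
      C (n * (n + a + b + 1)) * f := by
    rw [hypOp]; ring
  rw [this]
  rcases k with _ | _ | k <;>
    simp only [coeff_add, coeff_sub, coeff_C_mul, coeff_X_mul, mul_coeff_zero, coeff_X_zero,
      coeff_C_zero, coeff_derivative] <;> push_cast <;> ring

lemma hypOp_jac (n : ℕ) {a : ℝ} (ha : -1 < a) (b : ℝ) : hypOp n a b (jac n a b) = 0 := by
  ext k
  rw [coeff_hypOp, coeff_jac, coeff_jac, hypCoeff, coeff_zero]
  have h1 : (k : ℝ) + a + 1 ≠ 0 := by have : (0 : ℝ) ≤ k := k.cast_nonneg; linarith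
  have h2 : (k : ℝ) + 1 ≠ 0 := by positivity
  field_simp
  ring

lemma eq_jac_of_hypOp_eq_zero {n : ℕ} {a b : ℝ} (ha : -1 < a) {f : ℝ[X]}
    (hf : hypOp n a b f = 0) : f = C (f.coeff 0) * jac n a b := by
  ext k
  rw [coeff_C_mul, coeff_jac]
  induction k with
  | zero => simp [hypCoeff]
  | succ k ih =>
    have h := coeff_hypOp n a b f k
    rw [hf, coeff_zero] at h
    have h1 : (k : ℝ) + a + 1 ≠ 0 := by have : (0 : ℝ) ≤ k := k.cast_nonneg; linarith
    have h2 : (k : ℝ) + 1 ≠ 0 := by positivity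
    rw [hypCoeff, ← mul_assoc, ← ih]
    field_simp
    linarith

lemma coeff_zero_jac (n : ℕ) (a b : ℝ) : (jac n a b).coeff 0 = 1 := by
  rw [coeff_jac, hypCoeff]

lemma eval_zero_jac (n : ℕ) (a b : ℝ) : (jac n a b).eval 0 = 1 := by
  rw [← coeff_zero_eq_eval_zero, coeff_zero_jac]

/-- Rising factorial `(x)_n = x (x+1) ⋯ (x+n-1)`. -/
noncomputable def rise (x : ℝ) (n : ℕ) : ℝ := ∏ i ∈ Finset.range n, (x + i)

@[simp] lemma rise_zero (x : ℝ) : rise x 0 = 1 := by simp [rise]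

lemma rise_succ (x : ℝ) (n : ℕ) : rise x (n + 1) = rise x n * (x + n) := by
  simp [rise, Finset.prod_range_succ]

lemma rise_succ' (x : ℝ) (n : ℕ) : rise x (n + 1) = x * rise (x + 1) n := by
  rw [rise, Finset.prod_range_succ', rise, mul_comm]
  congr 1
  · simp
  · refine Finset.prod_congr rfl fun i _ => ?_
    push_cast; ring

lemma rise_add (x : ℝ) (m n : ℕ) : rise x (m + n) = rise x m * rise (x + m) n := by
  induction n with
  | zero => simp
  | succ n ih => rw [← add_assoc, rise_succ, ih, rise_succ]; push_cast; ring

lemma rise_pos {x : ℝ} (hx : 0 < x) (n : ℕ) : 0 < rise x n :=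
  Finset.prod_pos fun i _ => by positivity

lemma rise_nonneg {x : ℝ} (hx : 0 ≤ x) (n : ℕ) : 0 ≤ rise x n :=
  Finset.prod_nonneg fun i _ => by positivity

lemma hypCoeff_self (n : ℕ) {a : ℝ} (ha : -1 < a) (b : ℝ) :
    hypCoeff n a b n = (-1) ^ n * rise (n + a + b + 1) n / rise (a + 1) n := by
  have key : ∀ k ≤ n, hypCoeff n a b k * (rise (a + 1) k * k.factorial) =
      (-1) ^ k * n.descFactorial k * rise (n + a + b + 1) k := by
    intro k hk
    induction k with
    | zero => simp [hypCoeff]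
    | succ k ih =>
      have h1 : (k : ℝ) + a + 1 ≠ 0 := by have : (0 : ℝ) ≤ k := k.cast_nonneg; linarith
      have h2 : (k : ℝ) + 1 ≠ 0 := by positivity
      have ih := ih (by omega)
      rw [hypCoeff, rise_succ, rise_succ, Nat.factorial_succ, Nat.descFactorial_succ]
      push_cast [Nat.cast_sub (by omega : k ≤ n)]
      have e : ((k : ℝ) - n) * (k + n + a + b + 1) / ((k + a + 1) * (k + 1)) *
          ((a + 1 + k) * (k + 1)) = ((k : ℝ) - n) * (k + n + a + b + 1) := by
        field_simp; ring
      linear_combination (((k : ℝ) - n) * (k + n + a + b + 1)) * ih +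
        hypCoeff n a b k * rise (a + 1) k * k.factorial * e
  have h := key n le_rfl
  rw [Nat.descFactorial_self] at h
  have hp := rise_pos (show 0 < a + 1 by linarith) n
  have hf : (n.factorial : ℝ) ≠ 0 := by positivity
  rw [eq_div_iff hp.ne']
  apply mul_right_cancel₀ hf
  linarith

lemma jac_comp_one_sub (n : ℕ) {a b : ℝ} (ha : -1 < a) (hb : -1 < b) :
    (jac n a b).comp (1 - X) = C ((-1) ^ n * rise (b + 1) n / rise (a + 1) n) * jac n b a := by
  set f := (jac n a b).comp (1 - X) with hf
  have h0 : hypOp n b a f = 0 := by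
    have h := congrArg (fun p => p.comp (1 - X)) (hypOp_jac n ha b)
    simp only [hypOp, add_comp, mul_comp, sub_comp, X_comp, C_comp, zero_comp, one_comp] at h
    simp only [hypOp, hf, derivative_comp, derivative_mul, derivative_sub, derivative_one,
      derivative_X]
    simp only [map_add, map_mul, map_ofNat, map_one, map_natCast, zero_sub] at h ⊢
    rw [derivative_zero]
    linear_combination h
  have h1 := eq_jac_of_hypOp_eq_zero hb h0
  rw [h1]
  congr 2
  have hdeg : f.coeff n = (-1) ^ n * hypCoeff n a b n := by
    have : f = ∑ k ∈ Finset.range (n + 1), C (hypCoeff n a b k) * (1 - X) ^ k := by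
      rw [hf, jac]
      simp [monomial_comp]
    rw [this, finsetSum_coeff, Finset.sum_range_succ, Finset.sum_eq_zero, zero_add, coeff_C_mul]
    · have : (1 - X : ℝ[X]) ^ n = C ((-1) ^ n) * (X - C 1) ^ n := by
        rw [map_pow, ← mul_pow]; simp
      have h2 : ((X - C (1 : ℝ)) ^ n).coeff n = 1 := by
        have hm := (monic_X_sub_C (1 : ℝ)).pow n
        have hd : ((X - C (1 : ℝ)) ^ n).natDegree = n := by
          rw [natDegree_pow, natDegree_X_sub_C, mul_one]
        rw [Monic, leadingCoeff, hd] at hm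
        exact hm
      rw [this, coeff_C_mul, h2]; ring
    · intro k hk
      rw [coeff_C_mul]
      have : ((1 - X : ℝ[X]) ^ k).coeff n = 0 := by
        apply coeff_eq_zero_of_natDegree_lt
        refine lt_of_le_of_lt (natDegree_pow_le) ?_
        have : (1 - X : ℝ[X]).natDegree ≤ 1 := by compute_degree
        have := Finset.mem_range.1 hk
        nlinarith
      rw [this, mul_zero]
  have h2 := congrArg (fun p => p.coeff n) h1
  simp only [coeff_C_mul, coeff_jac, hdeg] at h2
  rw [hypCoeff_self n ha, hypCoeff_self n hb] at h2
  have hA := rise_pos (show 0 < a + 1 by linarith) n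
  have hB := rise_pos (show 0 < b + 1 by linarith) n
  have hs : (0 : ℝ) < n + a + b + 1 ∨ n = 0 := by
    rcases n with _ | n
    · exact Or.inr rfl
    · left; push_cast; have : (0 : ℝ) ≤ n := n.cast_nonneg; linarith
  have hR : rise ((n : ℝ) + a + b + 1) n ≠ 0 := by
    rcases hs with h | h
    · exact (rise_pos h n).ne'
    · subst h; simp
  have e : (n : ℝ) + b + a + 1 = n + a + b + 1 := by ring
  rw [e] at h2
  have hsq : ((-1 : ℝ) ^ n) * (-1) ^ n = 1 := by rw [← mul_pow]; simp
  have hne : ((-1 : ℝ) ^ n) ≠ 0 := by positivity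
  field_simp at h2 ⊢
  linarith

lemma derivative_jac (n : ℕ) {a : ℝ} (ha : -1 < a) (b : ℝ) :
    derivative (jac n a b) =
      C (-(n * (n + a + b + 1) / (a + 1))) * jac (n - 1) (a + 1) (b + 1) := by
  ext k
  rw [coeff_derivative, coeff_C_mul, coeff_jac, coeff_jac]
  rcases n with _ | n
  · simp [hypCoeff_eq_zero]
  have h0 : a + 1 ≠ 0 := by linarith
  induction k with
  | zero => simp [hypCoeff]; field_simp; ring
  | succ k ih =>
    have hk : (0 : ℝ) ≤ k := k.cast_nonneg
    have h1 : (k : ℝ) + a + 1 ≠ 0 := by linarith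
    have h1' : (k : ℝ) + 1 + a + 1 ≠ 0 := by linarith
    have h1'' : (k : ℝ) + (a + 1) + 1 ≠ 0 := by linarith
    have h2 : (k : ℝ) + 1 ≠ 0 := by positivity
    have h3 : (k : ℝ) + 1 + 1 ≠ 0 := by positivity
    rw [hypCoeff, hypCoeff.eq_2 (n + 1 - 1) (a + 1) (b + 1) k, ← mul_assoc, ← ih]
    simp only [Nat.add_sub_cancel]
    push_cast
    field_simp
    ring

/-- Raising the second parameter by one. -/
lemma jac_eq_raise (n : ℕ) {a b : ℝ} (ha : -1 < a) (hab : 0 < a + b + 1) :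
    jac n a b = C ((n + a + b + 1) / (2 * n + a + b + 1)) * jac n a (b + 1) +
      C (n / (2 * n + a + b + 1)) * jac (n - 1) a (b + 1) := by
  have hn : (0 : ℝ) ≤ n := n.cast_nonneg
  have hd : 2 * (n : ℝ) + a + b + 1 ≠ 0 := by linarith
  rcases n with _ | n
  · have : a + b + 1 ≠ 0 := by linarith
    simp [jac_zero, this]
  have key : ∀ k, hypCoeff (n + 1) a (b + 1) k * (n + 1 + a + b + 1) =
        hypCoeff (n + 1) a b k * (n + 1 + a + b + 1 + k) ∧
      hypCoeff n a (b + 1) k * (n + 1) = hypCoeff (n + 1) a b k * (n + 1 - k) := by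
    intro k
    induction k with
    | zero => simp [hypCoeff]
    | succ k ih =>
      obtain ⟨i1, i2⟩ := ih
      have hk : (0 : ℝ) ≤ k := k.cast_nonneg
      have h1 : (k : ℝ) + a + 1 ≠ 0 := by linarith
      have h2 : (k : ℝ) + 1 ≠ 0 := by positivity
      simp only [hypCoeff]
      push_cast
      constructor
      · field_simp
        linear_combination ((k : ℝ) - (n + 1)) * (k + (n + 1) + a + (b + 1) + 1) * i1
      · field_simp
        linear_combination ((k : ℝ) - n) * (k + n + a + (b + 1) + 1) * i2
  ext k
  obtain ⟨i1, i2⟩ := key k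
  simp only [coeff_add, coeff_C_mul, coeff_jac, Nat.add_sub_cancel]
  push_cast at hd ⊢
  rw [div_mul_eq_mul_div, div_mul_eq_mul_div, ← add_div, eq_div_iff hd]
  linear_combination -i1 - i2

/-- Quadratic transformation of the even Gegenbauer polynomials. -/
lemma jac_two_mul (k : ℕ) {c : ℝ} (hc : -1 < c) :
    jac (2 * k) c c = (jac k c (-1 / 2)).comp (4 * X * (1 - X)) := by
  set f := (jac k c (-1 / 2)).comp (4 * X * (1 - X)) with hf
  have h0 : hypOp (2 * k) c c f = 0 := by
    have h := congrArg (fun p => p.comp (4 * X * (1 - X))) (hypOp_jac k hc (-1 / 2))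
    simp only [hypOp, add_comp, mul_comp, sub_comp, X_comp, C_comp, zero_comp, one_comp] at h
    have e1 : derivative (4 * X * (1 - X) : ℝ[X]) = 4 * (1 - 2 * X) := by
      simp only [derivative_mul, derivative_sub, derivative_one, derivative_X,
        derivative_ofNat]
      ring
    have e2 : derivative (4 * (1 - 2 * X) : ℝ[X]) = -8 := by
      simp only [derivative_mul, derivative_sub, derivative_one, derivative_X,
        derivative_ofNat]
      ring
    have e3 : (C (c + -1 / 2 + 2) : ℝ[X]) = C c + 1 + C (1 / 2) := by
      rw [← C_1, ← C_add, ← C_add]; congr 1; ring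
    have e4 : (C ((k : ℝ) * (k + c + -1 / 2 + 1)) : ℝ[X]) =
        C (k : ℝ) * (C (k : ℝ) + C c + C (1 / 2)) := by
      rw [← C_add, ← C_add, ← C_mul]; congr 1; ring
    have e5 : (2 : ℝ[X]) * C (1 / 2) = 1 := by
      rw [← C_ofNat, ← C_mul]; norm_num
    rw [e3, e4] at h
    have d1 : derivative f =
        4 * (1 - 2 * X) * (derivative (jac k c (-1 / 2))).comp (4 * X * (1 - X)) := by
      rw [hf, derivative_comp, e1]
    have d2 : derivative (derivative f) =
        -8 * (derivative (jac k c (-1 / 2))).comp (4 * X * (1 - X)) +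
          4 * (1 - 2 * X) * (4 * (1 - 2 * X) *
            (derivative (derivative (jac k c (-1 / 2)))).comp (4 * X * (1 - X))) := by
      rw [d1, derivative_mul, derivative_comp, e1, e2]
    rw [hypOp, d2, d1, hf]
    push_cast
    simp only [map_add, map_mul, map_ofNat, map_one, map_natCast] at h e5 ⊢
    linear_combination 4 * h +
      (8 * X * (1 - X) * (derivative (jac k c (-1 / 2))).comp (4 * X * (1 - X)) -
        2 * (k : ℝ[X]) * (jac k c (-1 / 2)).comp (4 * X * (1 - X))) * e5
  have h1 := eq_jac_of_hypOp_eq_zero hc h0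
  have h2 : f.coeff 0 = 1 := by
    rw [coeff_zero_eq_eval_zero, hf, eval_comp]
    simp [eval_zero_jac]
  rw [h1, h2]; simp

end JacobiPolynomial

section JacobiFunctional

open Polynomial

/-- The normalized moment functional of the weight `z ^ a * (1 - z) ^ b` on `[0, 1]`. -/
noncomputable def jacFun (a b : ℝ) : ℝ[X] →ₗ[ℝ] ℝ :=
  lsum fun k => (rise (a + 1) k / rise (a + b + 2) k) • LinearMap.id

lemma jacFun_monomial (a b : ℝ) (k : ℕ) (c : ℝ) :
    jacFun a b (monomial k c) = rise (a + 1) k / rise (a + b + 2) k * c := by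
  simp [jacFun, lsum_apply]

lemma jacFun_one (a b : ℝ) : jacFun a b 1 = 1 := by
  rw [← monomial_zero_one, jacFun_monomial]; simp

lemma jacFun_C_mul (a b c : ℝ) (p : ℝ[X]) : jacFun a b (C c * p) = c * jacFun a b p := by
  rw [← smul_eq_C_mul, map_smul, smul_eq_mul]

variable {a b : ℝ}

lemma jacFun_X_mul (ha : -1 < a) (hb : -1 < b) (p : ℝ[X]) :
    jacFun a b (X * p) = (a + 1) / (a + b + 2) * jacFun (a + 1) b p := by
  induction p using Polynomial.induction_on' with
  | add p q hp hq => rw [mul_add, map_add, map_add, hp, hq]; ring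
  | monomial k c =>
    rw [X_mul_monomial, jacFun_monomial, jacFun_monomial, rise_succ', rise_succ',
      show a + b + 2 + 1 = a + 1 + b + 2 by ring]
    have h1 : a + b + 2 ≠ 0 := by linarith
    have h2 := (rise_pos (show 0 < a + 1 + b + 2 by linarith) k).ne'
    field_simp

lemma jacFun_one_sub_X_mul (ha : -1 < a) (hb : -1 < b) (p : ℝ[X]) :
    jacFun a b ((1 - X) * p) = (b + 1) / (a + b + 2) * jacFun a (b + 1) p := by
  induction p using Polynomial.induction_on' with
  | add p q hp hq => rw [mul_add, map_add, map_add, hp, hq]; ring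
  | monomial k c =>
    have hk : (0 : ℝ) ≤ k := k.cast_nonneg
    have h1 : a + b + 2 ≠ 0 := by linarith
    have h2 := (rise_pos (show 0 < a + b + 2 + 1 by linarith) k).ne'
    have h3 := (rise_pos (show 0 < a + b + 2 by linarith) k).ne'
    have h4 : a + b + 2 + k ≠ 0 := by linarith
    have h5 := rise_succ' (a + b + 2) k
    rw [rise_succ] at h5
    rw [sub_mul, one_mul, map_sub, X_mul_monomial, jacFun_monomial, jacFun_monomial,
      jacFun_monomial, rise_succ, rise_succ, show a + (b + 1) + 2 = a + b + 2 + 1 by ring]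
    field_simp
    linear_combination -c * (b + 1) * rise (a + 1) k * h5

/-- Integration by parts. -/
lemma jacFun_ibp (ha : -1 < a) (hb : -1 < b) (p : ℝ[X]) :
    jacFun a b ((C (a + 1) - C (a + b + 2) * X) * p + X * (1 - X) * derivative p) = 0 := by
  induction p using Polynomial.induction_on' with
  | add p q hp hq =>
    rw [derivative_add, mul_add, mul_add, add_add_add_comm, map_add, hp, hq, add_zero]
  | monomial k c =>
    have e : (C (a + 1) - C (a + b + 2) * X) * monomial k c +
        X * (1 - X) * derivative (monomial k c) =
        C (a + 1 + k) * monomial k c - C (a + b + 2 + k) * monomial (k + 1) c := by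
      rw [← C_mul_X_pow_eq_monomial, ← C_mul_X_pow_eq_monomial, derivative_C_mul,
        derivative_X_pow]
      rcases k with _ | k
      · simp; ring
      · simp only [Nat.add_sub_cancel, map_add]; ring
    rw [e, map_sub, jacFun_C_mul, jacFun_C_mul, jacFun_monomial, jacFun_monomial, rise_succ,
      rise_succ]
    have hk : (0 : ℝ) ≤ k := k.cast_nonneg
    have h3 := (rise_pos (show 0 < a + b + 2 by linarith) k).ne'
    have h4 : a + b + 2 + k ≠ 0 := by linarith
    field_simp
    ring

lemma jacFun_jac (N : ℕ) {σ : ℝ} (ha : -1 < a) (hb : -1 < b) (hσ : -1 < a + σ) :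
    jacFun a b (jac N (a + σ) b) =
      rise σ N * rise (b + 1) N / (rise (a + σ + 1) N * rise (a + b + 2) N) := by
  induction N generalizing b σ with
  | zero => simp [jac_zero, jacFun_one]
  | succ N ih =>
    have hN : (0 : ℝ) ≤ N := N.cast_nonneg
    set f := jac (N + 1) (a + σ) b with hf
    have hode := hypOp_jac (N + 1) hσ b
    have hd := derivative_jac (N + 1) hσ b
    rw [← hf, Nat.add_sub_cancel] at hd
    rw [← hf, hypOp] at hode
    have h1 := jacFun_ibp ha hb (derivative f)
    have e : X * (1 - X) * derivative (derivative f) +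
        (C (a + σ + 1) - C (a + σ + b + 2) * X) * derivative f =
        ((C (a + 1) - C (a + b + 2) * X) * derivative f + X * (1 - X) * derivative (derivative f))
          + C σ * ((1 - X) * derivative f) := by
      simp only [map_add]; ring
    have h2 := congrArg (jacFun a b) hode
    rw [e, map_add, map_add, h1, map_zero, zero_add, jacFun_C_mul, jacFun_C_mul,
      jacFun_one_sub_X_mul ha hb, hd, jacFun_C_mul, add_assoc a σ 1,
      ih (by linarith) (by linarith)] at h2
    rw [rise_succ' σ, rise_succ' (b + 1), rise_succ' (a + σ + 1), rise_succ' (a + b + 2)]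
    push_cast at h2
    have q1 : ((N : ℝ) + 1) * (N + 1 + (a + σ) + b + 1) ≠ 0 := by
      have : 0 < (N : ℝ) + 1 + (a + σ) + b + 1 := by linarith
      positivity
    have q2 : a + σ + 1 ≠ 0 := by linarith
    have q3 : a + b + 2 ≠ 0 := by linarith
    apply mul_left_cancel₀ q1
    rw [show a + (b + 1) + 2 = a + b + 2 + 1 by ring] at h2
    rw [← add_assoc] at h2
    have q4 := (rise_pos (show 0 < a + σ + 1 + 1 by linarith) N).ne'
    have q5 := (rise_pos (show 0 < a + b + 2 + 1 by linarith) N).ne'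
    rw [← add_assoc] at h2
    rw [← add_assoc _ a σ, eq_neg_of_add_eq_zero_right h2]
    field_simp

lemma jacFun_jac_mul (k : ℕ) (ha : -1 < a) (hb : -1 < b) (f : ℝ[X]) :
    jacFun a b (f * jac (k + 1) a b) = -((b + 1) / ((a + b + 2) * (a + b + 3))) *
      jacFun (a + 1) (b + 1) (derivative f * jac k (a + 1) (b + 1)) := by
  have hk : (0 : ℝ) ≤ k := k.cast_nonneg
  set F := jac (k + 1) a b with hF
  set r := jac k (a + 1) (b + 1) with hr
  have hode := hypOp_jac (k + 1) ha b
  have hd := derivative_jac (k + 1) ha b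
  rw [← hF, Nat.add_sub_cancel, ← hr] at hd
  rw [← hF, hypOp, hd, derivative_C_mul] at hode
  have q1 : ((k : ℝ) + 1) * (k + 1 + a + b + 1) ≠ 0 := by
    have : 0 < (k : ℝ) + 1 + a + b + 1 := by linarith
    positivity
  have q2 : a + 1 ≠ 0 := by linarith
  have hrod : C (a + 1) * F = (C (a + 1) - C (a + b + 2) * X) * r + X * (1 - X) * derivative r := by
    push_cast at hode
    set Λ := ((k : ℝ) + 1) * (k + 1 + a + b + 1)
    have hC : C (a + 1) * C (-(Λ / (a + 1))) = -C Λ := by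
      rw [← C_mul, ← C_neg]; congr 1; field_simp
    apply mul_left_cancel₀ (C_ne_zero.2 q1)
    linear_combination C (a + 1) * hode -
      ((C (a + 1) - C (a + b + 2) * X) * r + X * (1 - X) * derivative r) * hC
  have h1 := jacFun_ibp ha hb (r * f)
  have e : (C (a + 1) - C (a + b + 2) * X) * (r * f) + X * (1 - X) * derivative (r * f) =
      C (a + 1) * (f * F) + X * ((1 - X) * (derivative f * r)) := by
    rw [derivative_mul]
    linear_combination -f * hrod
  rw [e, map_add, jacFun_C_mul, jacFun_X_mul ha hb,
    jacFun_one_sub_X_mul (by linarith : -1 < a + 1) hb] at h1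
  have q3 : a + b + 2 ≠ 0 := by linarith
  have q4 : a + b + 3 ≠ 0 := by linarith
  rw [show a + 1 + b + 2 = a + b + 3 by ring] at h1
  apply mul_left_cancel₀ q2
  rw [eq_neg_of_add_eq_zero_left h1]
  field_simp

lemma jacFun_jac_mul_jac_eq_zero {N k : ℕ} (h : N < k) (ha : -1 < a) (hb : -1 < b) {σ : ℝ}
    (hσ : -1 < a + σ) : jacFun a b (jac N (a + σ) b * jac k a b) = 0 := by
  induction N generalizing a b k with
  | zero =>
    obtain ⟨k, rfl⟩ : ∃ j, k = j + 1 := ⟨k - 1, by omega⟩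
    rw [jacFun_jac_mul k ha hb, jac_zero, derivative_one]
    simp
  | succ N ih =>
    obtain ⟨k, rfl⟩ : ∃ j, k = j + 1 := ⟨k - 1, by omega⟩
    rw [jacFun_jac_mul k ha hb, derivative_jac _ hσ, Nat.add_sub_cancel, mul_assoc, jacFun_C_mul,
      show a + σ + 1 = a + 1 + σ by ring,
      ih (by omega) (by linarith) (by linarith) (by linarith)]
    simp

/-- The connection integral of two Jacobi polynomials with different first parameters. -/
lemma jacFun_jac_mul_jac (k m : ℕ) (ha : -1 < a) (hb : -1 < b) {σ : ℝ} (hσ : -1 < a + σ) :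
    jacFun a b (jac (k + m) (a + σ) b * jac k a b) =
      (k + m).factorial / m.factorial * rise (k + m + a + b + σ + 1) k * rise σ m *
        rise (b + 1) (k + m) / (rise (a + σ + 1) (k + m) * rise (a + b + 2) (k + m + k)) := by
  induction k generalizing a b with
  | zero =>
    have : (m.factorial : ℝ) ≠ 0 := by positivity
    simp [jac_zero, jacFun_jac m ha hb hσ, this]
  | succ k ih =>
    rw [jacFun_jac_mul k ha hb, derivative_jac _ hσ, show k + 1 + m - 1 = k + m by omega,
      mul_assoc, jacFun_C_mul, show a + σ + 1 = a + 1 + σ by ring,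
      ih (by linarith) (by linarith) (by linarith)]
    rw [show k + 1 + m = k + m + 1 by omega,
      show k + m + 1 + (k + 1) = k + m + k + 1 + 1 by omega, Nat.factorial_succ,
      rise_succ' _ k, rise_succ' _ (k + m), rise_succ' _ (k + m), rise_succ' _ (k + m + k + 1),
      rise_succ' _ (k + m + k)]
    push_cast
    have q1 : (m.factorial : ℝ) ≠ 0 := by positivity
    have q2 : a + 1 + σ ≠ 0 := by linarith
    have q3 : a + b + 2 ≠ 0 := by linarith
    have q4 : a + b + 3 ≠ 0 := by linarith
    have q5 := (rise_pos (show 0 < a + 1 + σ + 1 by linarith) (k + m)).ne'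
    have q6 := (rise_pos (show 0 < a + b + 4 by linarith) (k + m + k)).ne'
    rw [show a + 1 + (b + 1) + 2 = a + b + 4 by ring, show a + b + 2 + 1 + 1 = a + b + 4 by ring,
      show a + b + 2 + 1 = a + b + 3 by ring,
      show (k : ℝ) + m + (a + 1) + (b + 1) + σ + 1 = k + m + a + b + σ + 3 by ring,
      show (k : ℝ) + 1 + m + a + b + σ + 1 + 1 = k + m + a + b + σ + 3 by ring]
    field_simp
    ring

lemma jacFun_jac_sq_pos (k : ℕ) (ha : -1 < a) (hb : -1 < b) :
    0 < jacFun a b (jac k a b * jac k a b) := by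
  have h := jacFun_jac_mul_jac k 0 ha hb (σ := 0) (by linarith)
  simp only [add_zero] at h
  rw [h]
  have h0 : 0 < rise ((k : ℝ) + (0 : ℕ) + a + b + 1) k := by
    rcases k with _ | k
    · simp
    · apply rise_pos
      have : (0 : ℝ) ≤ k := k.cast_nonneg
      push_cast; linarith
  have h1 := rise_pos (show 0 < a + 1 by linarith) k
  have h2 := rise_pos (show 0 < b + 1 by linarith) k
  have h3 := rise_pos (show 0 < a + b + 2 by linarith) (k + k)
  simp only [rise_zero]
  positivity

/-- Connection coefficient of `jac n (a + σ) b` along `jac k a b`. -/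
noncomputable def conn (a b σ : ℝ) (n k : ℕ) : ℝ :=
  jacFun a b (jac n (a + σ) b * jac k a b) / jacFun a b (jac k a b * jac k a b)

lemma exists_eq_sum_jac (ha : -1 < a) (hb : -1 < b) (n : ℕ) (p : ℝ[X]) (hp : p.natDegree ≤ n) :
    ∃ c : ℕ → ℝ, p = ∑ k ∈ Finset.range (n + 1), C (c k) * jac k a b := by
  induction n generalizing p with
  | zero =>
    refine ⟨fun _ => p.coeff 0, ?_⟩
    simp only [zero_add, Finset.sum_range_one, jac_zero, mul_one]
    exact eq_C_of_natDegree_le_zero hp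
  | succ n ih =>
    have hl : (jac (n + 1) a b).coeff (n + 1) ≠ 0 := by
      rw [coeff_jac, hypCoeff_self _ ha]
      have hn : (0 : ℝ) ≤ n := n.cast_nonneg
      have h1 := rise_pos (show 0 < a + 1 by linarith) (n + 1)
      have h2 := rise_pos (show 0 < ((n + 1 : ℕ) : ℝ) + a + b + 1 by push_cast; linarith) (n + 1)
      have h3 : ((-1 : ℝ) ^ (n + 1)) ≠ 0 := pow_ne_zero _ (by norm_num)
      exact div_ne_zero (mul_ne_zero h3 h2.ne') h1.ne'
    set d := p.coeff (n + 1) / (jac (n + 1) a b).coeff (n + 1) with hd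
    obtain ⟨c, hc⟩ := ih (p - C d * jac (n + 1) a b) (by
      rw [natDegree_le_iff_coeff_eq_zero]
      intro k hk
      rw [coeff_sub, coeff_C_mul]
      rcases Nat.lt_or_ge (n + 1) k with h | h
      · rw [coeff_eq_zero_of_natDegree_lt (lt_of_le_of_lt hp h),
          coeff_eq_zero_of_natDegree_lt (lt_of_le_of_lt (natDegree_jac_le _ _ _) h)]
        simp
      · obtain rfl : k = n + 1 := by omega
        rw [hd, div_mul_cancel₀ _ hl, sub_self])
    refine ⟨fun k => if k = n + 1 then d else c k, ?_⟩
    dsimp only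
    rw [Finset.sum_range_succ, if_pos rfl, Finset.sum_congr rfl (fun k hk => ?_), ← hc]
    · ring
    · rw [if_neg (by have := Finset.mem_range.1 hk; omega)]

lemma jac_eq_sum_conn (ha : -1 < a) (hb : -1 < b) (σ : ℝ) (n : ℕ) :
    jac n (a + σ) b = ∑ k ∈ Finset.range (n + 1), C (conn a b σ n k) * jac k a b := by
  obtain ⟨c, hc⟩ := exists_eq_sum_jac ha hb n _ (natDegree_jac_le n (a + σ) b)
  have horth : ∀ j k, j ≠ k → jacFun a b (jac j a b * jac k a b) = 0 := by
    intro j k hjk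
    rcases lt_or_gt_of_ne hjk with h | h
    · simpa using jacFun_jac_mul_jac_eq_zero h ha hb (σ := 0) (by linarith)
    · rw [mul_comm]
      simpa using jacFun_jac_mul_jac_eq_zero h ha hb (σ := 0) (by linarith)
  rw [hc]
  refine Finset.sum_congr rfl fun k hk => ?_
  congr 2
  rw [conn, eq_div_iff (jacFun_jac_sq_pos k ha hb).ne', hc, Finset.sum_mul, map_sum,
    Finset.sum_eq_single k]
  · rw [mul_assoc, jacFun_C_mul]
  · intro j _ hj
    rw [mul_assoc, jacFun_C_mul, horth j k hj, mul_zero]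
  · intro h; exact absurd hk h

end JacobiFunctional

section RisingFactorialAsymptotics

open Asymptotics Filter Topology

/-- The normalized rising factorial `(x)_n / n!`. -/
noncomputable def rho (x : ℝ) (n : ℕ) : ℝ := rise x n / n.factorial

lemma rise_eq_rho (x : ℝ) (n : ℕ) : rise x n = rho x n * n.factorial := by
  have : (n.factorial : ℝ) ≠ 0 := by positivity
  rw [rho, div_mul_cancel₀ _ this]

lemma rho_zero (x : ℝ) : rho x 0 = 1 := by simp [rho]

lemma rho_pos {x : ℝ} (hx : 0 < x) (n : ℕ) : 0 < rho x n :=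
  div_pos (rise_pos hx n) (by positivity)

lemma rho_nonneg {x : ℝ} (hx : 0 ≤ x) (n : ℕ) : 0 ≤ rho x n :=
  div_nonneg (rise_nonneg hx n) (by positivity)

lemma isTheta_top_of_eq {ι : Type*} {f g : ι → ℝ} (h : ∀ i, f i = g i) : f =Θ[⊤] g := by
  rw [funext h]

lemma isTheta_top_comp {ι κ : Type*} {f g : ι → ℝ} (h : f =Θ[⊤] g) (k : κ → ι) :
    (fun i => f (k i)) =Θ[⊤] fun i => g (k i) :=
  ⟨h.1.comp_tendsto tendsto_top, h.2.comp_tendsto tendsto_top⟩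

lemma isTheta_top_of_tendsto {u : ℕ → ℝ} {l : ℝ} (hu : ∀ n, 0 < u n) (hl : 0 < l)
    (h : Tendsto u atTop (𝓝 l)) : u =Θ[⊤] fun _ => (1 : ℝ) := by
  constructor
  · obtain ⟨C, hC⟩ := h.bddAbove_range
    refine isBigO_top.2 ⟨C, fun n => ?_⟩
    rw [Real.norm_of_nonneg (hu n).le]
    simpa using hC ⟨n, rfl⟩
  · obtain ⟨C, hC⟩ := (h.inv₀ hl.ne').bddAbove_range
    refine isBigO_top.2 ⟨C, fun n => ?_⟩
    rw [Real.norm_of_nonneg (hu n).le, norm_one]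
    have h1 : (u n)⁻¹ ≤ C := hC ⟨n, rfl⟩
    have h2 : (u n)⁻¹ * u n = 1 := inv_mul_cancel₀ (hu n).ne'
    nlinarith [hu n]

lemma rho_isTheta {x : ℝ} (hx : 0 < x) :
    rho x =Θ[⊤] fun n : ℕ => ((n : ℝ) + 1) ^ (x - 1) := by
  have hpos : ∀ n : ℕ, 0 < rho x n / ((n : ℝ) + 1) ^ (x - 1) := fun n =>
    div_pos (rho_pos hx n) (by positivity)
  have hlim : Tendsto (fun n : ℕ => rho x n / ((n : ℝ) + 1) ^ (x - 1)) atTop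
      (𝓝 (Real.Gamma x)⁻¹) := by
    have hG := (Real.GammaSeq_tendsto_Gamma x).inv₀ (Real.Gamma_pos_of_pos hx).ne'
    have h1 : Tendsto (fun n : ℕ => (n : ℝ) / (n + 1)) atTop (𝓝 1) :=
      tendsto_natCast_div_add_atTop 1
    have h2 : Tendsto (fun n : ℕ => ((n : ℝ) / (n + x))) atTop (𝓝 1) :=
      tendsto_natCast_div_add_atTop x
    have h3 := ((h1.rpow_const (p := x - 1) (Or.inl one_ne_zero)).mul h2).mul hG
    rw [Real.one_rpow, one_mul, one_mul] at h3
    refine h3.congr' ?_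
    filter_upwards [eventually_gt_atTop 0] with n hn
    have hn' : (0 : ℝ) < n := by exact_mod_cast hn
    have hr : ∏ j ∈ Finset.range (n + 1), (x + (j : ℝ)) = rise x n * (x + n) := rise_succ x n
    rw [Real.GammaSeq, hr, Real.div_rpow hn'.le (by positivity), rho,
      show (n : ℝ) ^ x = n ^ (x - 1) * n by
        rw [← Real.rpow_add_one hn'.ne']; congr 1; ring]
    have q1 := rise_pos hx n
    have q2 : (0 : ℝ) < n.factorial := by positivity
    have q3 : (0 : ℝ) < (n : ℝ) ^ (x - 1) := by positivity
    have q4 : (0 : ℝ) < ((n : ℝ) + 1) ^ (x - 1) := by positivity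
    field_simp
    ring
  have h := (isTheta_top_of_tendsto hpos (inv_pos.2 (Real.Gamma_pos_of_pos hx)) hlim).mul
    (isTheta_refl (fun n : ℕ => ((n : ℝ) + 1) ^ (x - 1)) ⊤)
  refine (IsTheta.trans (isTheta_top_of_eq fun n => ?_) h).trans (isTheta_top_of_eq fun _ => ?_)
  · have q4 : (0 : ℝ) < ((n : ℝ) + 1) ^ (x - 1) := by positivity
    field_simp
  · simp

lemma rpow_le_of_comparable {x y : ℝ} (hx : 0 < x) (hy : 0 < y) (h1 : x ≤ 4 * y) (h2 : y ≤ 4 * x)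
    (e : ℝ) : x ^ e ≤ 4 ^ |e| * y ^ e := by
  have h : (x / y) ^ e ≤ 4 ^ |e| := by
    have hq : 0 < x / y := by positivity
    rcases le_total 0 e with he | he
    · rw [abs_of_nonneg he]
      exact Real.rpow_le_rpow hq.le ((div_le_iff₀ hy).2 h1) he
    · rw [abs_of_nonpos he, ← neg_neg e, Real.rpow_neg hq.le, ← Real.inv_rpow hq.le, neg_neg,
        inv_div]
      exact Real.rpow_le_rpow (by positivity) ((div_le_iff₀ hx).2 h2) (by linarith)
  rw [Real.div_rpow hx.le hy.le, div_le_iff₀ (by positivity)] at h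
  exact h

lemma isTheta_rpow_of_comparable {ι : Type*} {f g : ι → ℝ} (hf : ∀ i, 0 < f i) (hg : ∀ i, 0 < g i)
    (h1 : ∀ i, f i ≤ 4 * g i) (h2 : ∀ i, g i ≤ 4 * f i) (e : ℝ) :
    (fun i => f i ^ e) =Θ[⊤] fun i => g i ^ e := by
  constructor <;> refine isBigO_top.2 ⟨4 ^ |e|, fun i => ?_⟩ <;>
    rw [Real.norm_of_nonneg (Real.rpow_nonneg (hf i).le _),
      Real.norm_of_nonneg (Real.rpow_nonneg (hg i).le _)]
  · exact rpow_le_of_comparable (hf i) (hg i) (h1 i) (h2 i) e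
  · exact rpow_le_of_comparable (hg i) (hf i) (h2 i) (h1 i) e

lemma exists_le_of_isTheta {ι : Type*} {f g : ι → ℝ} (h : f =Θ[⊤] g) (hf : ∀ i, 0 ≤ f i)
    (hg : ∀ i, 0 ≤ g i) : ∃ c > 0, ∀ i, c * g i ≤ f i := by
  obtain ⟨C, hC⟩ := isBigO_top.1 h.2
  refine ⟨(max C 1)⁻¹, by positivity, fun i => ?_⟩
  have := hC i
  rw [Real.norm_of_nonneg (hf i), Real.norm_of_nonneg (hg i)] at this
  rw [inv_mul_le_iff₀ (by positivity)]
  exact this.trans (mul_le_mul_of_nonneg_right (le_max_left _ _) (hf i))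

lemma exists_ge_of_isTheta {ι : Type*} {f g : ι → ℝ} (h : f =Θ[⊤] g) (hf : ∀ i, 0 ≤ f i)
    (hg : ∀ i, 0 ≤ g i) : ∃ C > 0, ∀ i, f i ≤ C * g i := by
  obtain ⟨C, hC⟩ := isBigO_top.1 h.1
  refine ⟨max C 1, by positivity, fun i => ?_⟩
  have := hC i
  rw [Real.norm_of_nonneg (hf i), Real.norm_of_nonneg (hg i)] at this
  exact this.trans (mul_le_mul_of_nonneg_right (le_max_left _ _) (hg i))

/-- The factor of the connection integral that is comparable to a power of the degree. -/
noncomputable def connFactor (a b σ : ℝ) (k m : ℕ) : ℝ :=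
  rho (a + b + σ + 1) (k + m + k) * rho (b + 1) (k + m) /
    (rho (a + b + σ + 1) (k + m) * rho (a + σ + 1) (k + m) * rho (a + b + 2) (k + m + k))

variable {a b : ℝ}

lemma jacFun_jac_mul_jac_eq_connFactor (ha : -1 < a) (hb : -1 < b) {σ : ℝ} (hσ : -1 < a + σ)
    (hs : 0 < a + b + σ + 1) (k m : ℕ) :
    jacFun a b (jac (k + m) (a + σ) b * jac k a b) = rho σ m * connFactor a b σ k m := by
  have h := rise_add (a + b + σ + 1) (k + m) k
  rw [show a + b + σ + 1 + ((k + m : ℕ) : ℝ) = k + m + a + b + σ + 1 by push_cast; ring] at h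
  rw [jacFun_jac_mul_jac k m ha hb hσ, connFactor]
  simp only [rho]
  have q1 := rise_pos hs (k + m)
  have q2 := rise_pos (show 0 < a + b + 2 by linarith) (k + m + k)
  have q3 := rise_pos (show 0 < a + σ + 1 by linarith) (k + m)
  have q4 : (0 : ℝ) < m.factorial := by positivity
  have q5 : (0 : ℝ) < (k + m).factorial := by positivity
  have q6 : (0 : ℝ) < (k + m + k).factorial := by positivity
  rw [h]
  field_simp

lemma connFactor_pos (ha : -1 < a) (hb : -1 < b) {σ : ℝ} (hσ : -1 < a + σ)
    (hs : 0 < a + b + σ + 1) (k m : ℕ) : 0 < connFactor a b σ k m := by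
  have q1 := rho_pos hs (k + m)
  have q2 := rho_pos (show 0 < a + b + 2 by linarith) (k + m + k)
  have q3 := rho_pos (show 0 < a + σ + 1 by linarith) (k + m)
  have q4 := rho_pos (show 0 < b + 1 by linarith) (k + m)
  have q5 := rho_pos hs (k + m + k)
  unfold connFactor
  positivity

lemma connFactor_isTheta (ha : -1 < a) (hb : -1 < b) {σ : ℝ} (hσ : -1 < a + σ)
    (hs : 0 < a + b + σ + 1) :
    (fun p : ℕ × ℕ => connFactor a b σ p.1 p.2) =Θ[⊤]
      fun p => ((p.1 : ℝ) + p.2 + 1) ^ (-2 * a - σ - 1) := by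
  have h1 : ∀ x : ℝ, 0 < x → (fun p : ℕ × ℕ => rho x (p.1 + p.2)) =Θ[⊤]
      fun p => ((p.1 : ℝ) + p.2 + 1) ^ (x - 1) := fun x hx => by
    have := isTheta_top_comp (rho_isTheta hx) fun p : ℕ × ℕ => p.1 + p.2
    refine this.trans (isTheta_top_of_eq fun _ => ?_)
    simp
  have h2 : ∀ x : ℝ, 0 < x → (fun p : ℕ × ℕ => rho x (p.1 + p.2 + p.1)) =Θ[⊤]
      fun p => ((p.1 : ℝ) + p.2 + 1) ^ (x - 1) := fun x hx => by
    have := isTheta_top_comp (rho_isTheta hx) fun p : ℕ × ℕ => p.1 + p.2 + p.1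
    refine this.trans ?_
    refine isTheta_rpow_of_comparable (fun p => by positivity) (fun p => by positivity)
      (fun p => ?_) (fun p => ?_) _
    · push_cast
      have : (0 : ℝ) ≤ p.1 := p.1.cast_nonneg
      have : (0 : ℝ) ≤ p.2 := p.2.cast_nonneg
      linarith
    · push_cast
      have : (0 : ℝ) ≤ p.1 := p.1.cast_nonneg
      have : (0 : ℝ) ≤ p.2 := p.2.cast_nonneg
      linarith
  have h := ((h2 _ hs).mul (h1 (b + 1) (by linarith))).div
    (((h1 _ hs).mul (h1 (a + σ + 1) (by linarith))).mul (h2 (a + b + 2) (by linarith)))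
  refine IsTheta.trans h (isTheta_top_of_eq fun p => ?_)
  have hp : (0 : ℝ) < (p.1 : ℝ) + p.2 + 1 := by positivity
  rw [← Real.rpow_add hp, ← Real.rpow_add hp, ← Real.rpow_add hp, ← Real.rpow_sub hp]
  congr 1
  ring

lemma exists_le_jacFun_jac_mul_jac (ha : -1 < a) (hb : -1 < b) {σ : ℝ} (hσ : -1 < a + σ)
    (hs : 0 < a + b + σ + 1) :
    ∃ c > 0, ∀ k m : ℕ, 0 ≤ rho σ m → c * (rho σ m * ((k : ℝ) + m + 1) ^ (-2 * a - σ - 1)) ≤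
      jacFun a b (jac (k + m) (a + σ) b * jac k a b) := by
  obtain ⟨c, hc, h⟩ := exists_le_of_isTheta (connFactor_isTheta ha hb hσ hs)
    (fun p => (connFactor_pos ha hb hσ hs _ _).le) (fun p => by positivity)
  refine ⟨c, hc, fun k m hm => ?_⟩
  rw [jacFun_jac_mul_jac_eq_connFactor ha hb hσ hs, mul_left_comm]
  exact mul_le_mul_of_nonneg_left (h (k, m)) hm

lemma jacFun_jac_mul_jac_nonneg (ha : -1 < a) (hb : -1 < b) {σ : ℝ} (hσ : 0 ≤ σ)
    (hs : 0 < a + b + σ + 1) (n k : ℕ) :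
    0 ≤ jacFun a b (jac n (a + σ) b * jac k a b) := by
  rcases Nat.lt_or_ge n k with h | h
  · rw [jacFun_jac_mul_jac_eq_zero h ha hb (by linarith)]
  · obtain ⟨m, rfl⟩ := Nat.exists_eq_add_of_le h
    rw [jacFun_jac_mul_jac_eq_connFactor ha hb (by linarith) hs]
    exact mul_nonneg (rho_nonneg hσ m) (connFactor_pos ha hb (by linarith) hs k m).le

lemma conn_nonneg (ha : -1 < a) (hb : -1 < b) {σ : ℝ} (hσ : 0 ≤ σ)
    (hs : 0 < a + b + σ + 1) (n k : ℕ) : 0 ≤ conn a b σ n k :=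
  div_nonneg (jacFun_jac_mul_jac_nonneg ha hb hσ hs n k) (jacFun_jac_sq_pos k ha hb).le

lemma exists_le_conn (ha : -1 < a) (hb : -1 < b) (hab : 0 < a + b + 1) {σ : ℝ} (hσ : 0 ≤ σ) :
    ∃ c > 0, ∀ k m : ℕ, m ≤ k + 1 →
      c * (rho σ m * ((k : ℝ) + m + 1) ^ (-σ)) ≤ conn a b σ (k + m) k := by
  obtain ⟨c, hc, h⟩ := exists_le_jacFun_jac_mul_jac ha hb (σ := σ) (by linarith) (by linarith)
  obtain ⟨C, hC, h'⟩ := exists_ge_of_isTheta (connFactor_isTheta ha hb (σ := 0) (by linarith)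
    (by linarith)) (fun p => (connFactor_pos ha hb (by linarith) (by linarith) _ _).le)
    (fun p => by positivity)
  refine ⟨c / C * (4 ^ |-2 * a - 1|)⁻¹, by positivity, fun k m hm => ?_⟩
  have hsq := jacFun_jac_mul_jac_eq_connFactor ha hb (σ := 0) (by linarith) (by linarith) k 0
  rw [rho_zero, one_mul] at hsq
  simp only [add_zero] at hsq
  have hm' : (m : ℝ) ≤ k + 1 := by exact_mod_cast hm
  have hk : (0 : ℝ) ≤ k := k.cast_nonneg
  have hm0 : (0 : ℝ) ≤ m := m.cast_nonneg
  rw [conn, le_div_iff₀ (jacFun_jac_sq_pos k ha hb), hsq]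
  have h1 := h' (k, 0)
  simp only [Nat.cast_zero, add_zero, sub_zero] at h1
  have h2 := rpow_le_of_comparable (show (0 : ℝ) < k + 1 by linarith)
    (show (0 : ℝ) < k + m + 1 by linarith) (by linarith) (by linarith) (-2 * a - 1)
  have h3 := h k m (rho_nonneg hσ m)
  have hr := rho_nonneg hσ m
  set D : ℝ := 4 ^ |-2 * a - 1|
  have hD : 0 < D := by positivity
  have hkm : (0 : ℝ) < k + m + 1 := by linarith
  calc c / C * D⁻¹ * (rho σ m * ((k : ℝ) + m + 1) ^ (-σ)) * connFactor a b 0 k 0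
      ≤ c / C * D⁻¹ * (rho σ m * ((k : ℝ) + m + 1) ^ (-σ)) *
        (C * (D * ((k : ℝ) + m + 1) ^ (-2 * a - 1))) := by
        refine mul_le_mul_of_nonneg_left (h1.trans ?_) (by positivity)
        exact mul_le_mul_of_nonneg_left h2 hC.le
    _ = c * (rho σ m * ((k : ℝ) + m + 1) ^ (-2 * a - σ - 1)) := by
        rw [show -2 * a - σ - 1 = -σ + (-2 * a - 1) by ring, Real.rpow_add hkm]
        field_simp
    _ ≤ _ := h3

end RisingFactorialAsymptotics

section EvenAverage

open Polynomial Asymptotics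

lemma intervalIntegrable_one_sub_sq_rpow {s : ℝ} (hs : -1 < s) :
    IntervalIntegrable (fun t : ℝ => (1 - t ^ 2) ^ s) volume (-1) 1 := by
  have h0 : IntervalIntegrable (fun t : ℝ => (1 - t ^ 2) ^ s) volume 0 1 := by
    have h1 : IntervalIntegrable (fun t : ℝ => (1 - t) ^ s) volume 0 1 := by
      have := (intervalIntegral.intervalIntegrable_rpow' (a := 1) (b := 0) hs).comp_sub_left 1
      simpa using this
    have h2 : ContinuousOn (fun t : ℝ => (1 + t) ^ s) (Set.uIcc 0 1) := by
      rw [Set.uIcc_of_le zero_le_one]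
      refine ContinuousOn.rpow_const (by fun_prop) fun t ht => Or.inl ?_
      have := ht.1
      positivity
    refine (h1.mul_continuousOn h2).congr fun t ht => ?_
    rw [Set.uIoc_of_le zero_le_one] at ht
    rw [← Real.mul_rpow (by linarith [ht.2]) (by linarith [ht.1])]
    congr 1; ring
  have h1 : IntervalIntegrable (fun t : ℝ => (1 - t ^ 2) ^ s) volume (-1) 0 := by
    have := ((IntervalIntegrable.iff_comp_neg).1 h0).symm
    simpa using this
  exact h1.trans h0

/-- Even moments of the weight `(1 - t ^ 2) ^ (μ - 1)`, relative to the zeroth one. -/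
noncomputable def evenMoment (μ : ℝ) (l : ℕ) : ℝ := rise (1 / 2) l / rise (μ + 1 / 2) l

lemma intervalIntegrable_poly_mul {s : ℝ} (hs : -1 < s) (q : ℝ[X]) (y : ℝ) :
    IntervalIntegrable (fun t : ℝ => q.eval (t * y) * (1 - t ^ 2) ^ s) volume (-1) 1 :=
  (intervalIntegrable_one_sub_sq_rpow hs).continuousOn_mul (by fun_prop)

lemma integral_even_pow {μ : ℝ} (hμ : 0 < μ) (l : ℕ) :
    ∫ t in (-1 : ℝ)..1, t ^ (2 * l) * (1 - t ^ 2) ^ (μ - 1) =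
      (∫ t in (-1 : ℝ)..1, (1 - t ^ 2) ^ (μ - 1)) * evenMoment μ l := by
  have hI : ∀ m : ℕ, IntervalIntegrable (fun t : ℝ => t ^ m * (1 - t ^ 2) ^ (μ - 1))
      volume (-1) 1 := fun m =>
    (intervalIntegrable_one_sub_sq_rpow (by linarith)).continuousOn_mul (by fun_prop)
  induction l with
  | zero => simp [evenMoment]
  | succ l ih =>
    have hftc : ∫ t in (-1 : ℝ)..1, ((2 * l + 1) * (t ^ (2 * l) * (1 - t ^ 2) ^ (μ - 1)) -
        (2 * l + 1 + 2 * μ) * (t ^ (2 * (l + 1)) * (1 - t ^ 2) ^ (μ - 1))) = 0 := by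
      rw [intervalIntegral.integral_eq_sub_of_hasDerivAt_of_le
        (f := fun t : ℝ => t ^ (2 * l + 1) * (1 - t ^ 2) ^ μ) (by norm_num)]
      · simp [Real.zero_rpow hμ.ne']
      · refine ContinuousOn.mul (by fun_prop) ?_
        exact ContinuousOn.rpow_const (by fun_prop) fun t _ => Or.inr hμ.le
      · intro t ht
        have hpos : 0 < 1 - t ^ 2 := by nlinarith [ht.1, ht.2]
        have d1 : HasDerivAt (fun t : ℝ => 1 - t ^ 2) (-(2 * t)) t := by
          simpa using (hasDerivAt_pow 2 t).const_sub 1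
        have d2 := d1.rpow_const (p := μ) (Or.inl hpos.ne')
        have d3 := (hasDerivAt_pow (2 * l + 1) t).mul d2
        refine d3.congr_deriv ?_
        have e : (1 - t ^ 2) ^ μ = (1 - t ^ 2) ^ (μ - 1) * (1 - t ^ 2) := by
          rw [← Real.rpow_add_one hpos.ne']; congr 1; ring
        rw [e]
        push_cast
        ring
      · exact ((hI _).const_mul _).sub ((hI _).const_mul _)
    rw [intervalIntegral.integral_sub ((hI _).const_mul _) ((hI _).const_mul _),
      intervalIntegral.integral_const_mul, intervalIntegral.integral_const_mul, ih] at hftc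
    have hl : (0 : ℝ) ≤ l := l.cast_nonneg
    have h1 : 2 * (l : ℝ) + 1 + 2 * μ ≠ 0 := by positivity
    have h2 := (rise_pos (show 0 < μ + 1 / 2 by linarith) l).ne'
    have h3 : μ + 1 / 2 + l ≠ 0 := by positivity
    apply mul_left_cancel₀ h1
    rw [← sub_eq_zero.1 hftc, evenMoment, evenMoment, rise_succ, rise_succ]
    field_simp
    ring

/-- The effect on polynomials of averaging `q (t * y)` against `(1 - t ^ 2) ^ (μ - 1)`,
written in the variable `1 - y ^ 2`. -/
noncomputable def evenAvg (μ : ℝ) : ℝ[X] →ₗ[ℝ] ℝ[X] :=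
  lsum fun m => if Even m then
    evenMoment μ (m / 2) • (LinearMap.toSpanSingleton ℝ ℝ[X] ((1 - X) ^ (m / 2))) else 0

lemma evenAvg_monomial_even (μ : ℝ) (l : ℕ) (c : ℝ) :
    evenAvg μ (monomial (2 * l) c) = C (evenMoment μ l * c) * (1 - X) ^ l := by
  simp [evenAvg, lsum_apply, smul_eq_C_mul, mul_assoc]

lemma evenAvg_monomial_odd (μ : ℝ) (l : ℕ) (c : ℝ) :
    evenAvg μ (monomial (2 * l + 1) c) = 0 := by
  simp [evenAvg, lsum_apply]

lemma integral_eval_mul {μ : ℝ} (hμ : 0 < μ) (q : ℝ[X]) (y : ℝ) :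
    ∫ t in (-1 : ℝ)..1, q.eval (t * y) * (1 - t ^ 2) ^ (μ - 1) =
      (∫ t in (-1 : ℝ)..1, (1 - t ^ 2) ^ (μ - 1)) * (evenAvg μ q).eval (1 - y ^ 2) := by
  induction q using Polynomial.induction_on' with
  | add p q hp hq =>
    simp only [eval_add, add_mul, map_add, mul_add]
    rw [intervalIntegral.integral_add (intervalIntegrable_poly_mul (by linarith) _ _)
      (intervalIntegrable_poly_mul (by linarith) _ _), hp, hq]
  | monomial m c =>
    rcases Nat.even_or_odd' m with ⟨l, rfl | rfl⟩
    · have : ∀ t : ℝ, (monomial (2 * l) c).eval (t * y) * (1 - t ^ 2) ^ (μ - 1) =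
          c * y ^ (2 * l) * (t ^ (2 * l) * (1 - t ^ 2) ^ (μ - 1)) := fun t => by
        rw [eval_monomial, mul_pow]; ring
      simp only [this]
      rw [intervalIntegral.integral_const_mul, integral_even_pow hμ, evenAvg_monomial_even]
      simp only [eval_mul, eval_C, eval_pow, eval_sub, eval_one, eval_X]
      rw [pow_mul]; ring
    · rw [evenAvg_monomial_odd, eval_zero, mul_zero]
      have h := intervalIntegral.integral_comp_neg (a := -1) (b := 1)
        (fun t : ℝ => (monomial (2 * l + 1) c).eval (t * y) * (1 - t ^ 2) ^ (μ - 1))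
      have e : ∀ t : ℝ, (monomial (2 * l + 1) c).eval (-t * y) * (1 - (-t) ^ 2) ^ (μ - 1) =
          -((monomial (2 * l + 1) c).eval (t * y) * (1 - t ^ 2) ^ (μ - 1)) := fun t => by
        rw [eval_monomial, eval_monomial, neg_mul, Odd.neg_pow ⟨l, rfl⟩, neg_sq]; ring
      simp only [e, neg_neg] at h
      rw [intervalIntegral.integral_neg] at h
      linarith

lemma evenAvg_comp_neg (μ : ℝ) (q : ℝ[X]) : evenAvg μ (q.comp (-X)) = evenAvg μ q := by
  induction q using Polynomial.induction_on' with
  | add p q hp hq => rw [add_comp, map_add, map_add, hp, hq]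
  | monomial m c =>
    rw [monomial_comp, neg_pow, ← C_1, ← C_neg, ← C_pow, ← mul_assoc, ← C_mul,
      C_mul_X_pow_eq_monomial]
    rcases Nat.even_or_odd' m with ⟨l, rfl | rfl⟩
    · simp
    · rw [evenAvg_monomial_odd, evenAvg_monomial_odd]

/-- `evenAvg` in the variable of `jac`. -/
noncomputable def jacAvg (μ : ℝ) : ℝ[X] →ₗ[ℝ] ℝ[X] :=
  evenAvg μ ∘ₗ (aeval (C (1 / 2) * (1 - X) : ℝ[X])).toLinearMap

lemma jacAvg_apply (μ : ℝ) (p : ℝ[X]) :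
    jacAvg μ p = evenAvg μ (p.comp (C (1 / 2) * (1 - X))) := rfl

lemma integral_eval_jacAvg {μ : ℝ} (hμ : 0 < μ) (p : ℝ[X]) (y : ℝ) :
    ∫ t in (-1 : ℝ)..1, p.eval ((1 - t * y) / 2) * (1 - t ^ 2) ^ (μ - 1) =
      (∫ t in (-1 : ℝ)..1, (1 - t ^ 2) ^ (μ - 1)) * (jacAvg μ p).eval (1 - y ^ 2) := by
  rw [jacAvg_apply, ← integral_eval_mul hμ]
  refine intervalIntegral.integral_congr fun t _ => ?_
  simp only [eval_comp, eval_mul, eval_C, eval_sub, eval_one, eval_X]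
  congr 2; ring

lemma integral_one_sub_sq_rpow_pos {μ : ℝ} (hμ : 0 < μ) :
    0 < ∫ t in (-1 : ℝ)..1, (1 - t ^ 2) ^ (μ - 1) := by
  refine intervalIntegral.intervalIntegral_pos_of_pos_on
    (intervalIntegrable_one_sub_sq_rpow (by linarith)) (fun t ht => ?_) (by norm_num)
  have : 0 < 1 - t ^ 2 := by nlinarith [ht.1, ht.2]
  positivity

lemma jacAvg_jac_odd (μ : ℝ) {c : ℝ} (hc : -1 < c) {n : ℕ} (hn : Odd n) :
    jacAvg μ (jac n c c) = 0 := by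
  have h := jac_comp_one_sub n hc hc
  have hr := (rise_pos (show 0 < c + 1 by linarith) n).ne'
  rw [hn.neg_one_pow, neg_one_mul, neg_div, div_self hr] at h
  have h1 := evenAvg_comp_neg μ ((jac n c c).comp (C (1 / 2) * (1 - X)))
  have e : (C (1 / 2) * (1 - X) : ℝ[X]).comp (-X) = (1 - X : ℝ[X]).comp (C (1 / 2) * (1 - X)) := by
    have : (1 : ℝ[X]) = 2 * C (1 / 2) := by
      rw [← C_ofNat, ← C_mul]; norm_num
    simp only [mul_comp, sub_comp, one_comp, X_comp, C_comp]
    linear_combination -this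
  rw [comp_assoc, e, ← comp_assoc, h, mul_comp, C_comp, C_neg, C_1, neg_one_mul, map_neg] at h1
  rw [jacAvg_apply]
  exact self_eq_neg.1 h1.symm

lemma evenAvg_jac_comp_sq {μ c : ℝ} (hμ : 0 < μ) (k : ℕ) :
    evenAvg μ ((jac k (-1 / 2) c).comp (X ^ 2)) =
      (jac k (μ - 1 / 2) (c - μ)).comp (1 - X) := by
  have key : ∀ l, evenMoment μ l * hypCoeff k (-1 / 2) c l = hypCoeff k (μ - 1 / 2) (c - μ) l := by
    intro l
    induction l with
    | zero => simp [evenMoment, hypCoeff]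
    | succ l ih =>
      have hl : (0 : ℝ) ≤ l := l.cast_nonneg
      have h2 := (rise_pos (show 0 < μ + 1 / 2 by linarith) l).ne'
      have h3 : μ + 1 / 2 + l ≠ 0 := by positivity
      have h4 : (1 : ℝ) / 2 + l ≠ 0 := by positivity
      have h5 : (l : ℝ) + 1 ≠ 0 := by positivity
      rw [hypCoeff, hypCoeff, ← ih, evenMoment, evenMoment, rise_succ, rise_succ,
        show (l : ℝ) + -1 / 2 + 1 = 1 / 2 + l by ring,
        show (l : ℝ) + (μ - 1 / 2) + 1 = μ + 1 / 2 + l by ring,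
        show (l : ℝ) + k + (μ - 1 / 2) + (c - μ) + 1 = l + k + -1 / 2 + c + 1 by ring]
      generalize (1 : ℝ) / 2 + l = u at h4 ⊢
      generalize μ + 1 / 2 + l = v at h3 ⊢
      generalize rise (μ + 1 / 2) l = w at h2 ⊢
      field_simp
  rw [jac, jac]
  simp only [Polynomial.sum_comp, map_sum, monomial_comp]
  refine Finset.sum_congr rfl fun l _ => ?_
  rw [← pow_mul, C_mul_X_pow_eq_monomial, evenAvg_monomial_even, key]

/-- The eigenvalue-like factor in the averaging formula for even Gegenbauer polynomials. -/
noncomputable def avgFactor (μ c : ℝ) (k : ℕ) : ℝ :=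
  rise (1 / 2) k * rise (c - μ + 1) k / (rise (c + 1) k * rise (μ + 1 / 2) k)

lemma jacAvg_jac_even {μ c : ℝ} (hμ : 0 < μ) (hc : -1 < c - μ) (k : ℕ) :
    jacAvg μ (jac (2 * k) c c) = C (avgFactor μ c k) * jac k (c - μ) (μ - 1 / 2) := by
  have h1 := jac_comp_one_sub k (show -1 < c by linarith) (show (-1 : ℝ) < -1 / 2 by norm_num)
  have h2 := jac_comp_one_sub k (show -1 < μ - 1 / 2 by linarith) hc
  have e : (4 * X * (1 - X) : ℝ[X]).comp (C (1 / 2) * (1 - X)) =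
      (1 - X : ℝ[X]).comp (X ^ 2) := by
    have : (1 : ℝ[X]) = 2 * C (1 / 2) := by
      rw [← C_ofNat, ← C_mul]; norm_num
    simp only [mul_comp, sub_comp, one_comp, X_comp, ofNat_comp]
    set d : ℝ[X] := C (1 / 2)
    linear_combination ((1 - X) ^ 2 * (2 * d + 1) - 2 * (1 - X)) * this
  rw [jacAvg_apply, jac_two_mul k (by linarith), comp_assoc, e, ← comp_assoc, h1, mul_comp,
    C_comp, ← smul_eq_C_mul, map_smul, smul_eq_C_mul, evenAvg_jac_comp_sq hμ, h2, ← mul_assoc,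
    ← C_mul]
  congr 2
  have hsq : ((-1 : ℝ) ^ k) * (-1) ^ k = 1 := by rw [← mul_pow]; simp
  rw [avgFactor, show (-1 : ℝ) / 2 + 1 = 1 / 2 by norm_num,
    show μ - 1 / 2 + 1 = μ + 1 / 2 by ring, div_mul_div_comm]
  congr 1
  linear_combination rise (1 / 2) k * rise (c - μ + 1) k * hsq

lemma avgFactor_pos {μ c : ℝ} (hμ : 0 < μ) (hc : -1 < c - μ) (k : ℕ) : 0 < avgFactor μ c k := by
  have h1 := rise_pos (show (0 : ℝ) < 1 / 2 by norm_num) k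
  have h2 := rise_pos (show 0 < c - μ + 1 by linarith) k
  have h3 := rise_pos (show 0 < c + 1 by linarith) k
  have h4 := rise_pos (show 0 < μ + 1 / 2 by linarith) k
  unfold avgFactor
  positivity

lemma exists_le_avgFactor {μ c : ℝ} (hμ : 0 < μ) (hc : -1 < c - μ) :
    ∃ d > 0, ∀ k : ℕ, d * ((k : ℝ) + 1) ^ (-2 * μ) ≤ avgFactor μ c k := by
  refine exists_le_of_isTheta ?_ (fun k => (avgFactor_pos hμ hc k).le) (fun k => by positivity)
  have h := ((rho_isTheta (show (0 : ℝ) < 1 / 2 by norm_num)).mul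
    (rho_isTheta (show 0 < c - μ + 1 by linarith))).div
    ((rho_isTheta (show 0 < c + 1 by linarith)).mul
      (rho_isTheta (show 0 < μ + 1 / 2 by linarith)))
  refine ((isTheta_top_of_eq fun k => ?_).trans h).trans (isTheta_top_of_eq fun k => ?_)
  · simp only [avgFactor, rho]
    have : (k.factorial : ℝ) ≠ 0 := by positivity
    have h3 := rise_pos (show 0 < c + 1 by linarith) k
    have h4 := rise_pos (show 0 < μ + 1 / 2 by linarith) k
    field_simp
  · have hk : (0 : ℝ) < (k : ℝ) + 1 := by positivity
    rw [← Real.rpow_add hk, ← Real.rpow_add hk, ← Real.rpow_sub hk]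
    congr 1
    ring

end EvenAverage

section JacobiSupBound

open Polynomial Asymptotics

lemma abs_hypCoeff_le (n : ℕ) {a b : ℝ} (ha : 0 ≤ a) (hb : 0 ≤ b) (k : ℕ) :
    |hypCoeff n a b k| ≤ (n * (n + a + b + 1)) ^ k / k.factorial := by
  induction k with
  | zero => simp [hypCoeff]
  | succ k ih =>
    have hn : (0 : ℝ) ≤ n := n.cast_nonneg
    have hk : (0 : ℝ) ≤ k := k.cast_nonneg
    rcases Nat.lt_or_ge k n with h | h
    · have h' : (k : ℝ) ≤ n := by exact_mod_cast h.le
      have h1 : |((k : ℝ) - n) * (k + n + a + b + 1) / ((k + a + 1) * (k + 1))| ≤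
          n * (n + a + b + 1) / (k + 1) := by
        rw [abs_div, abs_mul, abs_of_nonpos (sub_nonpos.2 h'),
          abs_of_nonneg (show (0 : ℝ) ≤ k + n + a + b + 1 by positivity),
          abs_of_nonneg (show (0 : ℝ) ≤ (k + a + 1) * (k + 1) by positivity)]
        apply div_le_div₀ (by positivity) _ (by positivity) (by nlinarith)
        nlinarith [mul_nonneg hk ha, mul_nonneg hk hb]
      rw [hypCoeff, abs_mul, Nat.factorial_succ]
      refine (mul_le_mul ih h1 (abs_nonneg _) (by positivity)).trans (le_of_eq ?_)
      push_cast
      rw [pow_succ]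
      field_simp
    · rw [hypCoeff_eq_zero n a b (by omega), abs_zero]
      positivity

lemma abs_eval_jac_le (n : ℕ) {a b : ℝ} (ha : 0 ≤ a) (hb : 0 ≤ b) {z : ℝ} (hz : 0 ≤ z) :
    |(jac n a b).eval z| ≤ Real.exp (n * (n + a + b + 1) * z) := by
  have hn : (0 : ℝ) ≤ n := n.cast_nonneg
  rw [jac, eval_finsetSum]
  refine (Finset.abs_sum_le_sum_abs _ _).trans
    (le_trans (Finset.sum_le_sum fun k _ => ?_) (Real.sum_le_exp_of_nonneg (by positivity) (n + 1)))
  rw [eval_monomial, abs_mul, abs_of_nonneg (pow_nonneg hz k), mul_pow, mul_div_right_comm]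
  exact mul_le_mul_of_nonneg_right (abs_hypCoeff_le n ha hb k) (by positivity)

lemma abs_eval_derivative_jac_le (n : ℕ) {a b : ℝ} (ha : 0 ≤ a) (hb : 0 ≤ b) {z : ℝ} (hz : 0 ≤ z) :
    |(derivative (jac n a b)).eval z| ≤
      n * (n + a + b + 1) * Real.exp (n * (n + a + b + 1) * z) := by
  rw [derivative_jac n (by linarith)]
  rcases n with _ | n
  · simp
  have hn : (0 : ℝ) ≤ n := n.cast_nonneg
  rw [eval_mul, eval_C, abs_mul, abs_neg, Nat.add_sub_cancel]
  push_cast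
  refine mul_le_mul ?_ ((abs_eval_jac_le n (by linarith) (by linarith) hz).trans ?_)
    (abs_nonneg _) (by positivity)
  · rw [abs_of_nonneg (by positivity)]
    exact div_le_self (by positivity) (by linarith)
  · rw [Real.exp_le_exp]
    exact mul_le_mul_of_nonneg_right (by nlinarith) hz

/-- The derivative term in Sonin's function. -/
noncomputable def soninSlope (n : ℕ) (a b x : ℝ) : ℝ :=
  x * (1 - x) * (derivative (jac n a b)).eval x +
    (a + 1 / 2 - (a + b + 1) * x) * (jac n a b).eval x / 2

/-- The denominator in Sonin's function. -/
noncomputable def soninDenom (n : ℕ) (a b x : ℝ) : ℝ :=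
  (a + 1 / 2 - (a + b + 1) * x) * (1 - 2 * x - (a + 1 / 2 - (a + b + 1) * x)) / 4 +
    (n * (n + a + b + 1) + (a + b + 1) / 2) * (x * (1 - x))

/-- Sonin's function for `jac n a b`, with respect to the Liouville normal form of its
differential equation. -/
noncomputable def sonin (n : ℕ) (a b x : ℝ) : ℝ :=
  x ^ (a + 1 / 2) * (1 - x) ^ (b + 1 / 2) *
    ((jac n a b).eval x ^ 2 + soninSlope n a b x ^ 2 / soninDenom n a b x)

lemma soninDenom_eq (n : ℕ) (a b x : ℝ) :
    soninDenom n a b x = (n + (a + b + 1) / 2) ^ 2 * (x * (1 - x)) -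
      (a ^ 2 - 1 / 4) * (1 - x) / 4 - (b ^ 2 - 1 / 4) * x / 4 := by
  rw [soninDenom]
  ring

lemma hasDerivAt_sonin (n : ℕ) {a b x : ℝ} (ha : -1 < a) (hx0 : 0 < x) (hx1 : x < 1)
    (hD : soninDenom n a b x ≠ 0) :
    HasDerivAt (sonin n a b) (-(x ^ (a + 1 / 2) * (1 - x) ^ (b + 1 / 2) * soninSlope n a b x ^ 2 *
      (((a ^ 2 - 1 / 4) * (1 - x) ^ 2 - (b ^ 2 - 1 / 4) * x ^ 2) / 4) /
        (x * (1 - x) * soninDenom n a b x ^ 2))) x := by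
  have hode := congrArg (eval x) (hypOp_jac n ha b)
  simp only [hypOp, eval_add, eval_mul, eval_sub, eval_C, eval_X, eval_one, eval_zero] at hode
  have hf := (jac n a b).hasDerivAt x
  have hf' := (derivative (jac n a b)).hasDerivAt x
  have h1x : 0 < 1 - x := by linarith
  have hid := hasDerivAt_id' x
  have hsub : HasDerivAt (fun y : ℝ => 1 - y) (-1) x := hid.const_sub 1
  have hq : HasDerivAt (fun y : ℝ => y * (1 - y)) (1 - 2 * x) x := by
    refine (hid.mul hsub).congr_deriv ?_
    ring
  have hl : HasDerivAt (fun y : ℝ => a + 1 / 2 - (a + b + 1) * y) (-(a + b + 1)) x := by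
    simpa using (hid.const_mul (a + b + 1)).const_sub (a + 1 / 2)
  have hW : HasDerivAt (fun y : ℝ => y ^ (a + 1 / 2) * (1 - y) ^ (b + 1 / 2))
      (x ^ (a + 1 / 2) * (1 - x) ^ (b + 1 / 2) * (a + 1 / 2 - (a + b + 1) * x) /
        (x * (1 - x))) x := by
    refine ((hid.rpow_const (p := a + 1 / 2) (Or.inl hx0.ne')).mul
      (hsub.rpow_const (p := b + 1 / 2) (Or.inl h1x.ne'))).congr_deriv ?_
    rw [Real.rpow_sub_one hx0.ne', Real.rpow_sub_one h1x.ne']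
    field_simp
    ring
  have hDd := ((hl.mul ((hid.const_mul 2).const_sub 1 |>.sub hl)).div_const 4).add
    (hq.const_mul (n * (n + a + b + 1) + (a + b + 1) / 2))
  have hv := (hq.mul hf').add ((hl.mul hf).div_const 2)
  unfold soninDenom at hD
  have hE := hW.mul ((hf.pow 2).add ((hv.pow 2).div hDd hD))
  refine hE.congr_deriv ?_
  unfold soninSlope soninDenom
  simp only [Pi.add_apply, Pi.mul_apply, Pi.pow_apply, Pi.sub_apply, Pi.div_apply]
  set W := x ^ (a + 1 / 2) * (1 - x) ^ (b + 1 / 2)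
  set f := (jac n a b).eval x
  set f' := (derivative (jac n a b)).eval x
  set f'' := (derivative (derivative (jac n a b))).eval x
  generalize hDe : (a + 1 / 2 - (a + b + 1) * x) *
    (1 - 2 * x - (a + 1 / 2 - (a + b + 1) * x)) / 4 +
      (n * (n + a + b + 1) + (a + b + 1) / 2) * (x * (1 - x)) = D at hD ⊢
  generalize hve : x * (1 - x) * f' + (a + 1 / 2 - (a + b + 1) * x) * f / 2 = v
  have h1x' := h1x.ne'
  clear_value W f f' f''
  clear hE hv hDd hl hq hf hf' hW hid hsub ha hx1 h1x
  simp only [Nat.cast_ofNat, Nat.add_one_sub_one, pow_one]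
  have hv1 : (a + 1 / 2 - (a + b + 1) * x) * (f ^ 2 * D + v ^ 2) + 2 * f * f' * (x * (1 - x)) * D +
      2 * v * (x * (1 - x)) * ((1 - 2 * x) * f' + x * (1 - x) * f'' +
        (-(a + b + 1) * f + (a + 1 / 2 - (a + b + 1) * x) * f') / 2) - (1 - 2 * x) * v ^ 2 = 0 := by
    rw [← hDe, ← hve]
    linear_combination (2 * (x * (1 - x)) *
      (x * (1 - x) * f' + (a + 1 / 2 - (a + b + 1) * x) * f / 2)) * hode
  have hD1 : ((-(a + b + 1) * (1 - 2 * x - (a + 1 / 2 - (a + b + 1) * x)) +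
      (a + 1 / 2 - (a + b + 1) * x) * (-(2 * 1) - -(a + b + 1))) / 4 +
        (n * (n + a + b + 1) + (a + b + 1) / 2) * (1 - 2 * x)) * (x * (1 - x)) - D * (1 - 2 * x) =
      ((a ^ 2 - 1 / 4) * (1 - x) ^ 2 - (b ^ 2 - 1 / 4) * x ^ 2) / 4 := by
    rw [← hDe]
    ring
  rw [← hD1]
  generalize a + 1 / 2 - (a + b + 1) * x = l at *
  generalize (1 - 2 * x) * f' + x * (1 - x) * f'' + (-(a + b + 1) * f + l * f') / 2 = v1 at *
  clear hD1
  generalize (-(a + b + 1) * (1 - 2 * x - l) + l * (-(2 * 1) - -(a + b + 1))) / 4 +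
    (n * (n + a + b + 1) + (a + b + 1) / 2) * (1 - 2 * x) = D1 at *
  field_simp
  linear_combination (W * D) * hv1

lemma le_soninDenom (n : ℕ) {a b r s x : ℝ} (hs : s ^ 2 = a ^ 2 - 1 / 4)
    (hr : r ^ 2 = b ^ 2 - 1 / 4) (hr0 : 0 < r) (hx1 : x < 1)
    (hx : r * x ≤ s * (1 - x)) (hxn : s ^ 2 + r * s ≤ (n + (a + b + 1) / 2) ^ 2 * x) :
    3 / 4 * ((n + (a + b + 1) / 2) ^ 2 * (x * (1 - x))) ≤ soninDenom n a b x := by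
  rw [soninDenom_eq, ← hs, ← hr]
  nlinarith [mul_le_mul_of_nonneg_left hx hr0.le,
    mul_le_mul_of_nonneg_right hxn (sub_pos.2 hx1).le]

lemma mul_le_add_half_sq (n : ℕ) (a b : ℝ) :
    (n : ℝ) * (n + a + b + 1) ≤ (n + (a + b + 1) / 2) ^ 2 := by
  linarith [sq_nonneg (a + b + 1)]

lemma sq_eval_jac_le (n : ℕ) {a b x c : ℝ} (ha : 0 ≤ a) (hb : 0 ≤ b) (hx : 0 ≤ x)
    (hc : (n + (a + b + 1) / 2) ^ 2 * x ≤ c) : (jac n a b).eval x ^ 2 ≤ Real.exp c ^ 2 := by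
  refine sq_le_sq.2 (((abs_eval_jac_le n ha hb hx).trans ?_).trans (le_abs_self _))
  exact Real.exp_le_exp.2 ((mul_le_mul_of_nonneg_right (mul_le_add_half_sq n a b) hx).trans hc)

lemma sq_soninSlope_le (n : ℕ) {a b x c : ℝ} (ha : 0 ≤ a) (hb : 0 ≤ b) (hx0 : 0 ≤ x)
    (hx1 : x ≤ 1) (hc : (n + (a + b + 1) / 2) ^ 2 * x ≤ c) :
    soninSlope n a b x ^ 2 ≤
      2 * ((x * (1 - x)) ^ 2 * ((n + (a + b + 1) / 2) ^ 2 * Real.exp c) ^ 2) +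
        (a + b + 1) ^ 2 * Real.exp c ^ 2 / 2 := by
  have hf := sq_eval_jac_le n ha hb hx0 hc
  have hf' : (derivative (jac n a b)).eval x ^ 2 ≤
      ((n + (a + b + 1) / 2) ^ 2 * Real.exp c) ^ 2 := by
    refine sq_le_sq.2 (((abs_eval_derivative_jac_le n ha hb hx0).trans ?_).trans (le_abs_self _))
    refine mul_le_mul (mul_le_add_half_sq n a b) (Real.exp_le_exp.2 ?_) (Real.exp_pos _).le
      (sq_nonneg _)
    exact (mul_le_mul_of_nonneg_right (mul_le_add_half_sq n a b) hx0).trans hc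
  have hl : (a + 1 / 2 - (a + b + 1) * x) ^ 2 ≤ (a + b + 1) ^ 2 :=
    sq_le_sq' (by nlinarith) (by nlinarith)
  have h1 := mul_le_mul_of_nonneg_left hf' (sq_nonneg (x * (1 - x)))
  have h2 := mul_le_mul hl hf (sq_nonneg _) (sq_nonneg _)
  rw [soninSlope]
  refine add_sq_le.trans ?_
  rw [div_pow, mul_pow, mul_pow (a + 1 / 2 - _)]
  linarith

lemma sonin_le (n : ℕ) {a b r s x c : ℝ} (ha : 0 ≤ a) (hb : 0 ≤ b)
    (hs : s ^ 2 = a ^ 2 - 1 / 4) (hr : r ^ 2 = b ^ 2 - 1 / 4) (hr0 : 0 < r) (hs0 : 0 < s)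
    (hx0 : 0 < x) (hx1 : x < 1) (hx : r * x ≤ s * (1 - x)) (hc : c = s ^ 2 + r * s)
    (hxn : c = (n + (a + b + 1) / 2) ^ 2 * x) :
    sonin n a b x ≤ x ^ (a + 1 / 2) * (Real.exp c ^ 2 *
      (1 + 8 / 3 * c + 2 / 3 * ((a + b + 1) ^ 2 / (r * s)))) := by
  have hD := le_soninDenom n hs hr hr0 hx1 hx (hc.symm.trans hxn).le
  have h1x : 0 < 1 - x := by linarith
  have hslope := sq_soninSlope_le n ha hb hx0.le hx1.le hxn.ge
  have hf := sq_eval_jac_le n ha hb hx0.le hxn.ge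
  have hrs : 0 < r * s := by positivity
  have hc0 : 0 < c := by rw [hc]; positivity
  have hKq : r * s ≤ c * (1 - x) := by
    rw [hc]
    linarith [mul_le_mul_of_nonneg_left hx hs0.le]
  have hcq : c * (1 - x) ≤ c := mul_le_of_le_one_right hc0.le (by linarith)
  generalize hk : (n + (a + b + 1) / 2) ^ 2 * (x * (1 - x)) = k at hD
  have hkc : c * (1 - x) = k := by rw [hxn, ← hk]; ring
  rw [hkc] at hKq hcq
  have hk0 : 0 < k := by linarith
  have hD0 : 0 < soninDenom n a b x := lt_of_lt_of_le (by positivity) hD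
  rw [mul_pow _ (Real.exp c), ← mul_assoc (_ ^ 2), ← mul_pow, mul_comm (x * (1 - x)), hk] at hslope
  generalize Real.exp c ^ 2 = E at *
  have hE : 0 ≤ E := (sq_nonneg _).trans hf
  have hquot : soninSlope n a b x ^ 2 / soninDenom n a b x ≤
      E * (8 / 3 * c + 2 / 3 * ((a + b + 1) ^ 2 / (r * s))) := by
    rw [div_le_iff₀ hD0]
    refine hslope.trans (le_trans ?_ (mul_le_mul_of_nonneg_left hD (by positivity)))
    have h2 : (a + b + 1) ^ 2 ≤ (a + b + 1) ^ 2 / (r * s) * k := by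
      rw [div_mul_eq_mul_div, le_div_iff₀ hrs]
      exact mul_le_mul_of_nonneg_left hKq (sq_nonneg _)
    have h3 := mul_le_mul_of_nonneg_left hcq (show 0 ≤ 2 * E * k by positivity)
    have h4 := mul_le_mul_of_nonneg_left h2 (show 0 ≤ E / 2 by positivity)
    linarith
  rw [sonin, mul_assoc]
  refine mul_le_mul_of_nonneg_left ?_ (by positivity)
  have hW : (1 - x) ^ (b + 1 / 2) ≤ 1 := Real.rpow_le_one h1x.le (by linarith) (by linarith)
  refine (mul_le_mul hW (add_le_add hf hquot) (by positivity) zero_le_one).trans (le_of_eq ?_)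
  ring

lemma antitoneOn_sonin (n : ℕ) {a b r s x z : ℝ} (ha : -1 < a)
    (hs : s ^ 2 = a ^ 2 - 1 / 4) (hr : r ^ 2 = b ^ 2 - 1 / 4) (hr0 : 0 < r) (hs0 : 0 < s)
    (hx0 : 0 < x) (hz : z < 1) (hzr : r * z ≤ s * (1 - z)) (hK : 0 < n + (a + b + 1) / 2)
    (hxn : s ^ 2 + r * s ≤ (n + (a + b + 1) / 2) ^ 2 * x) :
    AntitoneOn (sonin n a b) (Set.Icc x z) := by
  have key : ∀ y ∈ Set.Icc x z, 0 < y ∧ y < 1 ∧ r * y ≤ s * (1 - y) ∧ 0 < soninDenom n a b y := by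
    rintro y ⟨hy1, hy2⟩
    have hy0 := hx0.trans_le hy1
    have hy3 := hy2.trans_lt hz
    have hy4 : r * y ≤ s * (1 - y) := by nlinarith
    refine ⟨hy0, hy3, hy4, lt_of_lt_of_le ?_ (le_soninDenom n hs hr hr0 hy3 hy4
      (hxn.trans (mul_le_mul_of_nonneg_left hy1 (sq_nonneg _))))⟩
    have := sub_pos.2 hy3
    positivity
  refine antitoneOn_of_deriv_nonpos (convex_Icc x z) (fun y hy => ?_) (fun y hy => ?_)
    (fun y hy => ?_)
  · obtain ⟨h0, h1, -, hD⟩ := key y hy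
    exact (hasDerivAt_sonin n ha h0 h1 hD.ne').continuousAt.continuousWithinAt
  · obtain ⟨h0, h1, -, hD⟩ := key y (interior_subset hy)
    exact (hasDerivAt_sonin n ha h0 h1 hD.ne').differentiableAt.differentiableWithinAt
  · obtain ⟨h0, h1, h2, hD⟩ := key y (interior_subset hy)
    rw [(hasDerivAt_sonin n ha h0 h1 hD.ne').deriv, neg_nonpos, ← hs, ← hr]
    have h1y := sub_pos.2 h1
    have : 0 ≤ s ^ 2 * (1 - y) ^ 2 - r ^ 2 * y ^ 2 := by
      have := pow_le_pow_left₀ (by positivity) h2 2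
      linarith [mul_pow r y 2, mul_pow s (1 - y) 2]
    positivity

lemma exists_weighted_sq_jac_le_left {a b r s : ℝ} (ha : 1 / 2 < a) (hb : 1 / 2 < b)
    (hs : s ^ 2 = a ^ 2 - 1 / 4) (hr : r ^ 2 = b ^ 2 - 1 / 4) (hr0 : 0 < r) (hs0 : 0 < s) :
    ∃ C, 0 < C ∧ ∀ (n : ℕ) (z : ℝ), 0 < z → z < 1 → r * z ≤ s * (1 - z) →
      z ^ (a + 1 / 2) * (1 - z) ^ (b + 1 / 2) * (jac n a b).eval z ^ 2 ≤
        C * ((n : ℝ) + 1) ^ (-2 * a - 1) := by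
  set c₀ : ℝ := s ^ 2 + r * s with hc₀
  have hc₀pos : 0 < c₀ := by positivity
  set M : ℝ := Real.exp c₀ ^ 2 * (1 + 8 / 3 * c₀ + 2 / 3 * ((a + b + 1) ^ 2 / (r * s))) with hM
  have hM1 : Real.exp c₀ ^ 2 ≤ M := by
    refine le_mul_of_one_le_right (by positivity) ?_
    have : 0 ≤ 8 / 3 * c₀ + 2 / 3 * ((a + b + 1) ^ 2 / (r * s)) := by positivity
    linarith
  have hM0 : 0 < M := lt_of_lt_of_le (by positivity) hM1
  refine ⟨c₀ ^ (a + 1 / 2) * M, by positivity, fun n z hz0 hz1 hz => ?_⟩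
  have hn : (0 : ℝ) ≤ n := n.cast_nonneg
  have h1z := sub_pos.2 hz1
  set K : ℝ := n + (a + b + 1) / 2 with hK
  have hK1 : (n : ℝ) + 1 ≤ K := by rw [hK]; linarith
  have hK0 : 0 < K := by linarith
  have hz₀ : c₀ = K ^ 2 * (c₀ / K ^ 2) := by field_simp
  have hz₀pos : 0 < c₀ / K ^ 2 := by positivity
  have hmain : (c₀ / K ^ 2) ^ (a + 1 / 2) * M ≤
      c₀ ^ (a + 1 / 2) * M * ((n : ℝ) + 1) ^ (-2 * a - 1) := by
    rw [Real.div_rpow hc₀pos.le (by positivity), div_eq_mul_inv, ← Real.rpow_neg (by positivity),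
      ← Real.rpow_natCast K 2, ← Real.rpow_mul hK0.le, mul_right_comm,
      show ((2 : ℕ) : ℝ) * -(a + 1 / 2) = -2 * a - 1 by push_cast; ring]
    exact mul_le_mul_of_nonneg_left
      (Real.rpow_le_rpow_of_nonpos (by positivity) hK1 (by linarith)) (by positivity)
  refine le_trans ?_ hmain
  rcases le_total z (c₀ / K ^ 2) with h | h
  · have hf : (jac n a b).eval z ^ 2 ≤ M := by
      refine (sq_eval_jac_le n (by linarith) (by linarith) hz0.le ?_).trans hM1
      exact (mul_le_mul_of_nonneg_left h (sq_nonneg K)).trans hz₀.ge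
    refine mul_le_mul ?_ hf (sq_nonneg _) (by positivity)
    refine (mul_le_of_le_one_right (by positivity)
      (Real.rpow_le_one h1z.le (by linarith) (by linarith))).trans ?_
    exact Real.rpow_le_rpow hz0.le h (by linarith)
  · have hx1 : c₀ / K ^ 2 < 1 := h.trans_lt hz1
    have hx : r * (c₀ / K ^ 2) ≤ s * (1 - c₀ / K ^ 2) := by nlinarith
    refine le_trans ?_ (((antitoneOn_sonin n (by linarith) hs hr hr0 hs0 hz₀pos hz1 hz hK0 hz₀.le)
      ⟨le_rfl, h⟩ ⟨h, le_rfl⟩ h).trans (sonin_le n (by linarith) (by linarith) hs hr hr0 hs0 hz₀pos hx1 hx hc₀ hz₀))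
    rw [sonin]
    refine mul_le_mul_of_nonneg_left (le_add_of_nonneg_right ?_) (by positivity)
    refine div_nonneg (sq_nonneg _) (le_trans (by positivity) (le_soninDenom n hs hr hr0 hz1 hz
      (hz₀.le.trans (mul_le_mul_of_nonneg_left h (sq_nonneg K)))))

lemma sq_eval_one_sub_jac (n : ℕ) {a b : ℝ} (ha : -1 < a) (hb : -1 < b) (z : ℝ) :
    (jac n a b).eval (1 - z) ^ 2 =
      (rho (b + 1) n / rho (a + 1) n) ^ 2 * (jac n b a).eval z ^ 2 := by
  have h := congrArg (eval z) (jac_comp_one_sub n ha hb)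
  rw [eval_comp, eval_sub, eval_one, eval_X, eval_mul, eval_C] at h
  have hfac : (n.factorial : ℝ) ≠ 0 := by positivity
  rw [h, rise_eq_rho, rise_eq_rho, mul_div_assoc, mul_div_mul_right _ _ hfac]
  simp only [mul_pow, ← pow_mul, mul_comm n 2]
  simp

lemma exists_weighted_sq_jac_le {a b : ℝ} (ha : 1 / 2 < a) (hb : 1 / 2 < b) :
    ∃ C, 0 < C ∧ ∀ (n : ℕ) (z : ℝ), 0 < z → z < 1 →
      z ^ (a + 1 / 2) * (1 - z) ^ (b + 1 / 2) * (jac n a b).eval z ^ 2 ≤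
        C * ((n : ℝ) + 1) ^ (-2 * a - 1) := by
  have hs0 : 0 < a ^ 2 - 1 / 4 := by nlinarith
  have hr0 : 0 < b ^ 2 - 1 / 4 := by nlinarith
  obtain ⟨C₁, hC₁, h₁⟩ := exists_weighted_sq_jac_le_left ha hb (Real.sq_sqrt hs0.le)
    (Real.sq_sqrt hr0.le) (Real.sqrt_pos.2 hr0) (Real.sqrt_pos.2 hs0)
  obtain ⟨C₂, hC₂, h₂⟩ := exists_weighted_sq_jac_le_left hb ha (Real.sq_sqrt hr0.le)
    (Real.sq_sqrt hs0.le) (Real.sqrt_pos.2 hs0) (Real.sqrt_pos.2 hr0)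
  obtain ⟨C₃, hC₃, h₃⟩ := exists_ge_of_isTheta
    (((rho_isTheta (show 0 < b + 1 by linarith)).div (rho_isTheta (show 0 < a + 1 by linarith))).pow 2)
    (fun n => sq_nonneg _) (fun n => sq_nonneg _)
  refine ⟨C₁ + C₃ * C₂, by positivity, fun n z hz0 hz1 => ?_⟩
  have hn : (0 : ℝ) < (n : ℝ) + 1 := by positivity
  rw [add_mul]
  rcases le_total (√(b ^ 2 - 1 / 4) * z) (√(a ^ 2 - 1 / 4) * (1 - z)) with h | h
  · exact (h₁ n z hz0 hz1 h).trans (le_add_of_nonneg_right (by positivity))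
  · refine le_trans ?_ (le_add_of_nonneg_left (by positivity))
    have h4 := h₂ n (1 - z) (by linarith) (by linarith) (by rwa [sub_sub_cancel])
    have h5 := sq_eval_one_sub_jac n (show -1 < a by linarith) (show -1 < b by linarith) (1 - z)
    rw [sub_sub_cancel] at h4 h5
    rw [h5, mul_left_comm, mul_comm (z ^ (a + 1 / 2))]
    refine (mul_le_mul (h₃ n) h4 ?_ ?_).trans (le_of_eq ?_)
    · have := sub_pos.2 hz1
      positivity
    · positivity
    · rw [mul_mul_mul_comm, add_sub_cancel_right, add_sub_cancel_right, ← Real.rpow_sub hn,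
        ← Real.rpow_natCast, ← Real.rpow_mul hn.le, ← Real.rpow_add hn]
      congr 2
      push_cast
      ring

/-- A weighted supremum bound for Jacobi polynomials, of the sharp order in the degree. -/
lemma exists_weighted_jac_le {a b p q : ℝ} (ha : 1 / 2 < a) (hb : 1 / 2 < b)
    (hp : (a + 1 / 2) / 2 ≤ p) (hq : (b + 1 / 2) / 2 ≤ q) :
    ∃ C, 0 < C ∧ ∀ (n : ℕ) (z : ℝ), 0 ≤ z → z ≤ 1 →
      z ^ p * (1 - z) ^ q * |(jac n a b).eval z| ≤ C * ((n : ℝ) + 1) ^ (-a - 1 / 2) := by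
  obtain ⟨C, hC, h⟩ := exists_weighted_sq_jac_le ha hb
  refine ⟨√C, Real.sqrt_pos.2 hC, fun n z hz0 hz1 => ?_⟩
  have hn : (0 : ℝ) < (n : ℝ) + 1 := by positivity
  rcases hz0.eq_or_lt with rfl | hz0
  · rw [Real.zero_rpow (by linarith), zero_mul, zero_mul]
    positivity
  rcases hz1.eq_or_lt with rfl | hz1
  · rw [sub_self, Real.zero_rpow (by linarith), mul_zero, zero_mul]
    positivity
  have h1z := sub_pos.2 hz1
  refine (sq_le_sq₀ (by positivity) (by positivity)).1 ?_
  rw [mul_pow, mul_pow, mul_pow, sq_abs, Real.sq_sqrt hC.le, ← Real.rpow_natCast (z ^ p),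
    ← Real.rpow_natCast ((1 - z) ^ q), ← Real.rpow_natCast (((n : ℝ) + 1) ^ _),
    ← Real.rpow_mul hz0.le, ← Real.rpow_mul h1z.le, ← Real.rpow_mul hn.le]
  refine le_trans ?_ ((h n z hz0 hz1).trans (le_of_eq ?_))
  · refine mul_le_mul_of_nonneg_right (mul_le_mul ?_ ?_ (by positivity) (by positivity)) (sq_nonneg _)
    · exact Real.rpow_le_rpow_of_exponent_ge hz0 hz1.le (by push_cast; linarith)
    · exact Real.rpow_le_rpow_of_exponent_ge h1z (by linarith) (by push_cast; linarith)
  · congr 2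
    push_cast
    ring

end JacobiSupBound

section JacobiExpansion

open Polynomial

lemma genBinom_eq_choose (x : ℝ) (k : ℕ) : genBinom x k = Ring.choose x k := by
  have h : (descPochhammer ℤ k).smeval x = ∏ i ∈ Finset.range k, (x - i) := by
    rw [← descPochhammer_eval_eq_prod_range, ← eval₂_smulOneHom_eq_smeval, ← eval_map,
      descPochhammer_map]
  rw [genBinom, ← h, Ring.choose_eq_smul, smul_eq_mul, div_eq_inv_mul]

lemma genBinom_succ (x : ℝ) (k : ℕ) : genBinom x (k + 1) = genBinom x k * ((x - k) / (k + 1)) := by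
  have : (k.factorial : ℝ) ≠ 0 := by positivity
  have hk : (k : ℝ) + 1 ≠ 0 := by positivity
  rw [genBinom, genBinom, Finset.prod_range_succ, Nat.factorial_succ]
  push_cast
  field_simp

lemma genBinom_add_one_succ (x : ℝ) (k : ℕ) :
    genBinom (x + 1) (k + 1) = genBinom x k * ((x + 1) / (k + 1)) := by
  have : (k.factorial : ℝ) ≠ 0 := by positivity
  have hk : (k : ℝ) + 1 ≠ 0 := by positivity
  rw [genBinom, genBinom, Finset.prod_range_succ', Nat.factorial_succ]
  have : ∀ i : ℕ, x + 1 - ((i + 1 : ℕ) : ℝ) = x - i := fun i => by push_cast; ring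
  simp only [this]
  push_cast
  field_simp
  ring

lemma rho_mul_hypCoeff (n : ℕ) {a : ℝ} (b : ℝ) (ha : -1 < a) {k : ℕ} (hk : k ≤ n) :
    rho (a + 1) n * hypCoeff n a b k =
      (-1) ^ k * (genBinom (n + a) (n - k) * genBinom (n + k + a + b) k) := by
  induction k with
  | zero =>
    rw [rho, rise, hypCoeff, genBinom, ← Finset.prod_range_reflect]
    simp only [Nat.sub_zero, mul_one, pow_zero, one_mul, genBinom, Finset.prod_range_zero,
      Nat.factorial_zero, Nat.cast_one, div_one]
    congr 1
    refine Finset.prod_congr rfl fun i hi => ?_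
    rw [Finset.mem_range] at hi
    rw [Nat.cast_sub (by omega), Nat.cast_sub (by omega)]
    push_cast
    ring
  | succ k ih =>
    have hk0 : (0 : ℝ) ≤ k := k.cast_nonneg
    have h1 : (k : ℝ) + 1 ≠ 0 := by positivity
    have h2 : (k : ℝ) + a + 1 ≠ 0 := by linarith
    have h3 : genBinom (n + a) (n - k) = genBinom (n + a) (n - (k + 1)) *
        ((a + k + 1) / (n - k)) := by
      rw [show n - k = n - (k + 1) + 1 by omega, genBinom_succ, Nat.cast_sub hk]
      push_cast
      congr 2 <;> ring
    have h4 := genBinom_add_one_succ (n + k + a + b) k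
    rw [show (n : ℝ) + k + a + b + 1 = n + (k + 1 : ℕ) + a + b by push_cast; ring] at h4
    have h5 : (n : ℝ) - k ≠ 0 := by
      have : (k : ℝ) + 1 ≤ n := by exact_mod_cast hk
      linarith
    rw [hypCoeff, ← mul_assoc, ih (by omega), h4, h3]
    push_cast
    field_simp
    ring

lemma neg_pow_mul_one_sub_pow (z : ℝ) {m n : ℕ} (h : m ≤ n) :
    (-z) ^ m * (1 - z) ^ (n - m) =
      ∑ k ∈ Finset.Ico m (n + 1), ((n - m).choose (k - m) : ℝ) * (-z) ^ k := by
  rw [Finset.sum_Ico_eq_sum_range, show (1 : ℝ) - z = -z + 1 by ring, add_pow, Finset.mul_sum,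
    show n + 1 - m = n - m + 1 by omega]
  refine Finset.sum_congr rfl fun j _ => ?_
  rw [one_pow, Nat.add_sub_cancel_left, pow_add]
  ring

lemma sum_choose_mul_genBinom (a b : ℝ) {k n : ℕ} (hk : k ≤ n) :
    ∑ m ∈ Finset.range (k + 1), genBinom (n + a) (n - m) * genBinom (n + b) m *
        ((n - m).choose (k - m) : ℝ) =
      genBinom (n + a) (n - k) * genBinom (n + k + a + b) k := by
  have h := Ring.add_choose_eq (r := (n : ℝ) + b) (s := (k : ℝ) + a) k (Commute.all _ _)
  rw [Finset.Nat.sum_antidiagonal_eq_sum_range_succ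
    fun i j => Ring.choose ((n : ℝ) + b) i * Ring.choose ((k : ℝ) + a) j] at h
  rw [genBinom_eq_choose (n + k + a + b), show (n : ℝ) + k + a + b = n + b + (k + a) by ring, h,
    Finset.mul_sum]
  refine Finset.sum_congr rfl fun m hm => ?_
  have hm' : m ≤ k := by rw [Finset.mem_range] at hm; omega
  have h2 := Ring.choose_smul_choose ((n : ℝ) + a) (show n - k ≤ n - m by omega)
  rw [show n - m - (n - k) = k - m by omega, nsmul_eq_mul, Nat.cast_sub hk,
    show (n : ℝ) + a - (n - k) = k + a by ring,
    ← Nat.choose_symm (show n - k ≤ n - m by omega), show n - m - (n - k) = k - m by omega] at h2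
  rw [genBinom_eq_choose, genBinom_eq_choose, genBinom_eq_choose]
  linear_combination Ring.choose ((n : ℝ) + b) m * h2

/-- The Rodrigues-type sum defining `jacobiP` is a multiple of the hypergeometric polynomial
`jac`. -/
lemma jacobiP_eq (n : ℕ) {a : ℝ} (b : ℝ) (ha : -1 < a) (x : ℝ) :
    jacobiP n a b x = rho (a + 1) n * (jac n a b).eval ((1 - x) / 2) := by
  set z := (1 - x) / 2 with hz
  have hl : jacobiP n a b x = ∑ m ∈ Finset.range (n + 1), ∑ k ∈ Finset.Ico m (n + 1),
      genBinom (n + a) (n - m) * genBinom (n + b) m * ((n - m).choose (k - m) : ℝ) * (-z) ^ k := by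
    rw [jacobiP]
    refine Finset.sum_congr rfl fun m hm => ?_
    rw [Finset.mem_range] at hm
    rw [show (x - 1) / 2 = -z by rw [hz]; ring, show (x + 1) / 2 = 1 - z by rw [hz]; ring,
      mul_assoc, neg_pow_mul_one_sub_pow z (by omega), Finset.mul_sum]
    exact Finset.sum_congr rfl fun k _ => by ring
  rw [hl, Finset.sum_comm' (t' := Finset.range (n + 1)) (s' := fun k => Finset.range (k + 1))
    (fun m k => by simp only [Finset.mem_range, Finset.mem_Ico]; omega), jac, eval_finsetSum,
    Finset.mul_sum]
  refine Finset.sum_congr rfl fun k hk => ?_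
  rw [Finset.mem_range] at hk
  rw [← Finset.sum_mul, sum_choose_mul_genBinom a b (by omega), eval_monomial, ← mul_assoc,
    rho_mul_hypCoeff n b ha (by omega), neg_pow]
  ring

end JacobiExpansion

section Duality

open Polynomial

variable {a b : ℝ}

lemma intervalIntegrable_jacobi_weight (ha : 0 ≤ a) (hb : 0 < b) {f : ℝ → ℝ} (hf : Continuous f) :
    IntervalIntegrable (fun y : ℝ => f y * ((1 - y ^ 2) ^ a * y ^ (2 * b + 1))) volume 0 1 := by
  refine Continuous.intervalIntegrable (hf.mul (Continuous.mul ?_ ?_)) 0 1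
  · exact Continuous.rpow_const (by fun_prop) fun _ => Or.inr ha
  · exact Continuous.rpow_const continuous_id fun _ => Or.inr (by linarith)

lemma integral_one_sub_sq_pow_mul (ha : 0 ≤ a) (hb : 0 < b) (k : ℕ) :
    ∫ y in (0 : ℝ)..1, (1 - y ^ 2) ^ k * ((1 - y ^ 2) ^ a * y ^ (2 * b + 1)) =
      (∫ y in (0 : ℝ)..1, (1 - y ^ 2) ^ a * y ^ (2 * b + 1)) *
        (rise (a + 1) k / rise (a + b + 2) k) := by
  have hI : ∀ m : ℕ, IntervalIntegrable
      (fun y : ℝ => (1 - y ^ 2) ^ m * ((1 - y ^ 2) ^ a * y ^ (2 * b + 1))) volume 0 1 := fun m =>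
    intervalIntegrable_jacobi_weight ha hb (by fun_prop)
  induction k with
  | zero => simp
  | succ k ih =>
    have hk : (0 : ℝ) ≤ k := k.cast_nonneg
    have hftc : ∫ y in (0 : ℝ)..1,
        (2 * (a + b + k + 2) * ((1 - y ^ 2) ^ (k + 1) * ((1 - y ^ 2) ^ a * y ^ (2 * b + 1))) -
          2 * (a + k + 1) * ((1 - y ^ 2) ^ k * ((1 - y ^ 2) ^ a * y ^ (2 * b + 1)))) = 0 := by
      rw [intervalIntegral.integral_eq_sub_of_hasDerivAt_of_le
        (f := fun y : ℝ => (1 - y ^ 2) ^ (a + k + 1) * y ^ (2 * b + 2)) (by norm_num)]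
      · simp [Real.zero_rpow (show a + k + 1 ≠ 0 by positivity),
          Real.zero_rpow (show 2 * b + 2 ≠ 0 by positivity)]
      · refine ContinuousOn.mul ?_ ?_
        · exact ContinuousOn.rpow_const (by fun_prop) fun t _ => Or.inr (by positivity)
        · exact ContinuousOn.rpow_const (by fun_prop) fun t _ => Or.inr (by positivity)
      · intro y hy
        have hpos : 0 < 1 - y ^ 2 := by nlinarith [hy.1, hy.2]
        have d1 : HasDerivAt (fun t : ℝ => 1 - t ^ 2) (-(2 * y)) y := by
          simpa using (hasDerivAt_pow 2 y).const_sub 1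
        have d2 := d1.rpow_const (p := a + k + 1) (Or.inl hpos.ne')
        have d3 := (hasDerivAt_id' y).rpow_const (p := 2 * b + 2) (Or.inl hy.1.ne')
        refine (d2.mul d3).congr_deriv ?_
        rw [show 2 * b + 2 - 1 = 2 * b + 1 by ring, show 2 * b + 2 = 2 * b + 1 + 1 by ring,
          Real.rpow_add_one hy.1.ne', add_sub_cancel_right, Real.rpow_add_one hpos.ne',
          Real.rpow_add_natCast hpos.ne']
        ring
      · exact ((hI _).const_mul _).sub ((hI _).const_mul _)
    rw [intervalIntegral.integral_sub ((hI _).const_mul _) ((hI _).const_mul _),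
      intervalIntegral.integral_const_mul, intervalIntegral.integral_const_mul, ih] at hftc
    have h1 : 2 * (a + b + k + 2) ≠ 0 := by positivity
    have h2 := (rise_pos (show 0 < a + b + 2 by linarith) k).ne'
    have h3 : a + b + 2 + k ≠ 0 := by positivity
    apply mul_left_cancel₀ h1
    rw [sub_eq_zero.1 hftc, rise_succ, rise_succ]
    field_simp
    ring

lemma integral_eval_one_sub_sq (ha : 0 ≤ a) (hb : 0 < b) (p : ℝ[X]) :
    ∫ y in (0 : ℝ)..1, p.eval (1 - y ^ 2) * ((1 - y ^ 2) ^ a * y ^ (2 * b + 1)) =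
      (∫ y in (0 : ℝ)..1, (1 - y ^ 2) ^ a * y ^ (2 * b + 1)) * jacFun a b p := by
  induction p using Polynomial.induction_on' with
  | add p q hp hq =>
    rw [map_add, mul_add, ← hp, ← hq, ← intervalIntegral.integral_add
      (intervalIntegrable_jacobi_weight ha hb (by fun_prop))
      (intervalIntegrable_jacobi_weight ha hb (by fun_prop))]
    simp only [eval_add, add_mul]
  | monomial k c =>
    simp only [eval_monomial, mul_assoc]
    rw [intervalIntegral.integral_const_mul, integral_one_sub_sq_pow_mul ha hb, jacFun_monomial]
    ring

lemma integral_jacobi_weight_pos (ha : 0 ≤ a) (hb : 0 < b) :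
    0 < ∫ y in (0 : ℝ)..1, (1 - y ^ 2) ^ a * y ^ (2 * b + 1) := by
  refine intervalIntegral.intervalIntegral_pos_of_pos_on ?_ (fun y hy => ?_) one_pos
  · simpa using intervalIntegrable_jacobi_weight ha hb (f := fun _ => 1) continuous_const
  · have : 0 < 1 - y ^ 2 := by nlinarith [hy.1, hy.2]
    have := hy.1
    positivity

/-- Lower bound for the double integral by duality: testing against a polynomial `F` whose
weighted supremum is at most `M`. -/
lemma exists_le_integral_abs_jacAvg {lam mu p : ℝ} (hlam : 0 ≤ lam) (hmu : 0 < mu)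
    (hp : 0 ≤ lam - 1 / 2 + p) {i : ℕ} (hi : 1 ≤ i) :
    ∃ c, 0 < c ∧ ∀ (Q F : ℝ[X]) (M : ℝ),
      (∀ z : ℝ, 0 ≤ z → z ≤ 1 → z ^ p * (1 - z) ^ (i : ℝ) * |F.eval z| ≤ M) →
      c * jacFun (lam - 1 / 2 + p) (mu - 1 / 2 + i) (jacAvg mu Q * F) ≤
        M * ∫ y in (0 : ℝ)..1,
          |∫ t in (-1 : ℝ)..1, Q.eval ((1 - t * y) / 2) * (1 - t ^ 2) ^ (mu - 1)| *
            (|y| ^ (2 * mu) * (1 - y ^ 2) ^ (lam - 1 / 2)) := by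
  have hi' : (1 : ℝ) ≤ i := by exact_mod_cast hi
  have hb : 0 < mu - 1 / 2 + i := by linarith
  have hκ := integral_one_sub_sq_rpow_pos hmu
  refine ⟨(∫ t in (-1 : ℝ)..1, (1 - t ^ 2) ^ (mu - 1)) *
    ∫ y in (0 : ℝ)..1, (1 - y ^ 2) ^ (lam - 1 / 2 + p) * y ^ (2 * (mu - 1 / 2 + i) + 1),
    mul_pos hκ (integral_jacobi_weight_pos hp hb), fun Q F M hM => ?_⟩
  simp only [integral_eval_jacAvg hmu]
  set κ := ∫ t in (-1 : ℝ)..1, (1 - t ^ 2) ^ (mu - 1)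
  rw [mul_assoc, ← integral_eval_one_sub_sq hp hb, ← intervalIntegral.integral_const_mul,
    ← intervalIntegral.integral_const_mul]
  refine intervalIntegral.integral_mono_on_of_le_Ioo zero_le_one
    ((intervalIntegrable_jacobi_weight hp hb (by fun_prop)).const_mul _) ?_ fun y hy => ?_
  · have h1 : IntervalIntegrable (fun y : ℝ => (1 - y ^ 2) ^ (lam - 1 / 2)) volume 0 1 :=
      (intervalIntegrable_one_sub_sq_rpow (by linarith)).mono_set
        (by rw [Set.uIcc_of_le (by norm_num), Set.uIcc_of_le (by norm_num)]
            exact Set.Icc_subset_Icc_left (by norm_num))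
    have h2 : Continuous fun y : ℝ => |y| ^ (2 * mu) :=
      Continuous.rpow_const continuous_abs fun _ => Or.inr (by linarith)
    exact (((h1.continuousOn_mul h2.continuousOn).continuousOn_mul
      (Continuous.continuousOn (by fun_prop))).const_mul _)
  · have hy0 := hy.1
    have hpos : 0 < 1 - y ^ 2 := by nlinarith [hy.1, hy.2]
    have h := hM (1 - y ^ 2) hpos.le (by nlinarith)
    rw [sub_sub_cancel, Real.rpow_natCast, ← pow_mul] at h
    have h3 : y ^ (2 * (mu - 1 / 2 + i) + 1) = y ^ (2 * mu) * y ^ (2 * i) := by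
      rw [← Real.rpow_add_natCast hy0.ne']
      congr 1
      push_cast
      ring
    rw [eval_mul, abs_of_pos hy0, Real.rpow_add hpos, h3, abs_mul, abs_of_pos hκ]
    set u := (jacAvg mu Q).eval (1 - y ^ 2)
    have h4 : u * F.eval (1 - y ^ 2) ≤ |u| * |F.eval (1 - y ^ 2)| := by
      rw [← abs_mul]; exact le_abs_self _
    have h5 : 0 ≤ (1 - y ^ 2) ^ p * y ^ (2 * i) := by positivity
    have h6 : 0 ≤ (1 - y ^ 2) ^ (lam - 1 / 2) * y ^ (2 * mu) * κ := by positivity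
    calc κ * (u * F.eval (1 - y ^ 2) * ((1 - y ^ 2) ^ (lam - 1 / 2) * (1 - y ^ 2) ^ p *
            (y ^ (2 * mu) * y ^ (2 * i))))
        = (1 - y ^ 2) ^ (lam - 1 / 2) * y ^ (2 * mu) * κ *
            ((1 - y ^ 2) ^ p * y ^ (2 * i) * (u * F.eval (1 - y ^ 2))) := by ring
      _ ≤ (1 - y ^ 2) ^ (lam - 1 / 2) * y ^ (2 * mu) * κ *
            ((1 - y ^ 2) ^ p * y ^ (2 * i) * (|u| * |F.eval (1 - y ^ 2)|)) :=
          mul_le_mul_of_nonneg_left (mul_le_mul_of_nonneg_left h4 h5) h6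
      _ = (1 - y ^ 2) ^ (lam - 1 / 2) * y ^ (2 * mu) * κ * |u| *
            ((1 - y ^ 2) ^ p * y ^ (2 * i) * |F.eval (1 - y ^ 2)|) := by ring
      _ ≤ (1 - y ^ 2) ^ (lam - 1 / 2) * y ^ (2 * mu) * κ * |u| * M :=
          mul_le_mul_of_nonneg_left h (mul_nonneg h6 (abs_nonneg _))
      _ = M * (κ * |u| * (y ^ (2 * mu) * (1 - y ^ 2) ^ (lam - 1 / 2))) := by ring

end Duality

section Reduction

open Polynomial

lemma integral_abs_jacobiP (n : ℕ) {A : ℝ} (B : ℝ) (hA : -1 < A) (lam mu : ℝ) :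
    ∫ y in (0 : ℝ)..1, |∫ t in (-1 : ℝ)..1, jacobiP n A B (t * y) * (1 - t ^ 2) ^ (mu - 1)| *
        (|y| ^ (2 * mu) * (1 - y ^ 2) ^ (lam - 1 / 2)) =
      rho (A + 1) n * ∫ y in (0 : ℝ)..1,
        |∫ t in (-1 : ℝ)..1, (jac n A B).eval ((1 - t * y) / 2) * (1 - t ^ 2) ^ (mu - 1)| *
          (|y| ^ (2 * mu) * (1 - y ^ 2) ^ (lam - 1 / 2)) := by
  rw [← intervalIntegral.integral_const_mul]
  refine intervalIntegral.integral_congr fun y _ => ?_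
  simp only [jacobiP_eq n B hA, mul_assoc, intervalIntegral.integral_const_mul, abs_mul,
    abs_of_pos (rho_pos (show 0 < A + 1 by linarith) n)]

/-- It suffices to bound from below a moment of the averaged polynomial against a test Jacobi
polynomial of half the degree. -/
lemma exists_le_integral_of_moment {lam mu A a p : ℝ} (B : ℝ) (hlam : 0 ≤ lam) (hmu : 0 < mu)
    (hA : -1 < A) (ha : 1 / 2 < a) (hp : (a + 1 / 2) / 2 ≤ p) {i : ℕ} (hi : 1 ≤ i)
    (hmi : mu ≤ i) {L : ℕ → ℝ} (hL : ∀ n, 2 ≤ n → 0 ≤ L n)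
    (h : ∃ c : ℝ, 0 < c ∧ ∀ n : ℕ, 2 ≤ n → c * (((n / 2 : ℕ) : ℝ) + 1) ^ (-mu - 1 - A - a) * L n ≤
      jacFun (lam - 1 / 2 + p) (mu - 1 / 2 + i)
        (jacAvg mu (jac n A B) * jac (n / 2) a (mu - 1 / 2 + i))) :
    ∃ c : ℝ, 0 < c ∧ ∀ n : ℕ, 2 ≤ n → c * (n : ℝ) ^ (-mu - 1 / 2) * L n ≤
      ∫ y in (0 : ℝ)..1, |∫ t in (-1 : ℝ)..1, jacobiP n A B (t * y) * (1 - t ^ 2) ^ (mu - 1)| *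
        (|y| ^ (2 * mu) * (1 - y ^ 2) ^ (lam - 1 / 2)) := by
  have hi' : (1 : ℝ) ≤ i := by exact_mod_cast hi
  obtain ⟨c, hc, h⟩ := h
  obtain ⟨c₁, hc₁, h₁⟩ := exists_le_integral_abs_jacAvg hlam hmu (p := p) (by linarith) hi
  obtain ⟨C, hC, h₂⟩ := exists_weighted_jac_le (a := a) (b := mu - 1 / 2 + i) (q := i) ha
    (by linarith) hp (by linarith)
  obtain ⟨c₃, hc₃, h₃⟩ := exists_le_of_isTheta (rho_isTheta (show 0 < A + 1 by linarith))
    (fun n => (rho_pos (show 0 < A + 1 by linarith) n).le) (fun n => by positivity)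
  refine ⟨c * c₁ * c₃ / C * (4 ^ |A|)⁻¹ * (4 ^ |-mu - 1 / 2|)⁻¹, by positivity, fun n hn => ?_⟩
  rw [integral_abs_jacobiP n B hA]
  set I := ∫ y in (0 : ℝ)..1,
    |∫ t in (-1 : ℝ)..1, (jac n A B).eval ((1 - t * y) / 2) * (1 - t ^ 2) ^ (mu - 1)| *
      (|y| ^ (2 * mu) * (1 - y ^ 2) ^ (lam - 1 / 2))
  have hX : (0 : ℝ) < ((n / 2 : ℕ) : ℝ) + 1 := by positivity
  have hn0 : (0 : ℝ) < n := by exact_mod_cast (by omega : 0 < n)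
  have e1 : (((n / 2 : ℕ) : ℝ) + 1) ≤ n := by exact_mod_cast (by omega : n / 2 + 1 ≤ n)
  have e2 : (n : ℝ) + 1 ≤ 2 * (((n / 2 : ℕ) : ℝ) + 1) := by
    exact_mod_cast (by omega : n + 1 ≤ 2 * (n / 2 + 1))
  set X := ((n / 2 : ℕ) : ℝ) + 1
  have k1 := h₁ (jac n A B) (jac (n / 2) a (mu - 1 / 2 + i)) (C * X ^ (-a - 1 / 2)) (h₂ _)
  have k2 := h n hn
  have k3 := h₃ n
  have k4 := rpow_le_of_comparable hX (show (0 : ℝ) < n + 1 by linarith) (by linarith)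
    (by linarith) A
  have k5 := rpow_le_of_comparable hn0 hX (by linarith) (by linarith) (-mu - 1 / 2)
  rw [add_sub_cancel_right] at k3
  have hLn := hL n hn
  set D : ℝ := 4 ^ |A|
  set E : ℝ := 4 ^ |-mu - 1 / 2|
  have hD : 0 < D := by positivity
  have hE : 0 < E := by positivity
  have k6 : c * c₁ / C * (X ^ (-mu - 1 / 2 - A) * L n) ≤ I := by
    have hpos : 0 < C * X ^ (-a - 1 / 2) := by positivity
    refine le_of_mul_le_mul_left (le_trans ?_ k1) hpos
    refine le_trans (le_of_eq ?_) (mul_le_mul_of_nonneg_left k2 hc₁.le)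
    rw [show -mu - 1 - A - a = (-mu - 1 / 2 - A) + (-a - 1 / 2) by ring, Real.rpow_add hX]
    field_simp
  have k7 : c₃ * (D⁻¹ * X ^ A) ≤ rho (A + 1) n := by
    refine le_trans (mul_le_mul_of_nonneg_left ?_ hc₃.le) k3
    rw [inv_mul_le_iff₀ hD]
    exact k4
  calc c * c₁ * c₃ / C * D⁻¹ * E⁻¹ * (n : ℝ) ^ (-mu - 1 / 2) * L n
      = c * c₁ * c₃ / C * D⁻¹ * (E⁻¹ * (n : ℝ) ^ (-mu - 1 / 2)) * L n := by ring
    _ ≤ c * c₁ * c₃ / C * D⁻¹ * X ^ (-mu - 1 / 2) * L n := by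
        refine mul_le_mul_of_nonneg_right (mul_le_mul_of_nonneg_left ?_ (by positivity)) hLn
        rw [inv_mul_le_iff₀ hE]
        exact k5
    _ = c₃ * (D⁻¹ * X ^ A) * (c * c₁ / C * (X ^ (-mu - 1 / 2 - A) * L n)) := by
        rw [show -mu - 1 / 2 = A + (-mu - 1 / 2 - A) by ring, Real.rpow_add hX,
          show A + (-mu - 1 / 2 - A) - A = -mu - 1 / 2 - A by ring]
        ring
    _ ≤ rho (A + 1) n * I := by
        refine mul_le_mul k7 k6 (by positivity) (rho_pos (by linarith) n).le

end Reduction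

section Raising

open Polynomial

variable {a b : ℝ} (Λ : ℝ[X] →ₗ[ℝ] ℝ)

lemma map_C_mul (c : ℝ) (q : ℝ[X]) : Λ (C c * q) = c * Λ q := by
  rw [← smul_eq_C_mul, map_smul, smul_eq_mul]

lemma map_jac_eq_raise (n : ℕ) (ha : -1 < a) (hab : 0 < a + b + 1) :
    Λ (jac n a b) = (n + a + b + 1) / (2 * n + a + b + 1) * Λ (jac n a (b + 1)) +
      n / (2 * n + a + b + 1) * Λ (jac (n - 1) a (b + 1)) := by
  rw [jac_eq_raise n ha hab, map_add, map_C_mul, map_C_mul]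

lemma map_jac_raise_le (ha : -1 < a) (hab : 0 < a + b + 1) {N : ℕ} (i : ℕ)
    (h : ∀ k ≤ N, 0 ≤ Λ (jac k a (b + i))) :
    ∀ k ≤ N, 0 ≤ Λ (jac k a b) ∧ Λ (jac k a (b + i)) ≤ 2 ^ i * Λ (jac k a b) := by
  induction i generalizing b with
  | zero => intro k hk; simpa using h k hk
  | succ i ih =>
    have e : b + ((i + 1 : ℕ) : ℝ) = b + 1 + i := by push_cast; ring
    rw [e] at h ⊢
    have h' := ih (by linarith) h
    intro k hk
    have hk0 : (0 : ℝ) ≤ k := k.cast_nonneg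
    obtain ⟨h1, h2⟩ := h' k hk
    obtain ⟨h3, -⟩ := h' (k - 1) (by omega)
    have hd : 0 < 2 * (k : ℝ) + a + b + 1 := by linarith
    have h4 : Λ (jac k a (b + 1)) ≤ 2 * Λ (jac k a b) := by
      rw [map_jac_eq_raise Λ k ha hab]
      have h5 : 1 / 2 ≤ ((k : ℝ) + a + b + 1) / (2 * k + a + b + 1) := by
        rw [div_le_div_iff₀ two_pos hd]; linarith
      have h6 : 0 ≤ (k : ℝ) / (2 * k + a + b + 1) * Λ (jac (k - 1) a (b + 1)) :=
        mul_nonneg (div_nonneg hk0 hd.le) h3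
      have h7 := mul_le_mul_of_nonneg_right h5 h1
      linarith
    refine ⟨by linarith, h2.trans ?_⟩
    rw [pow_succ, mul_assoc]
    exact mul_le_mul_of_nonneg_left h4 (by positivity)

lemma map_jac_even_raise_le (ha : -1 < a) (hab : 0 < a + b + 1) {n : ℕ} (i : ℕ)
    (h : ∀ k ≤ n, 0 ≤ Λ (jac k a (b + (i + 1 : ℕ)))) :
    Λ (jac (2 * (n / 2)) a (b + (i + 1 : ℕ))) ≤ 2 ^ i * (a + b + 3) * Λ (jac n a b) := by
  have e : b + ((i + 1 : ℕ) : ℝ) = b + 1 + i := by push_cast; ring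
  rw [e] at h ⊢
  have h' := map_jac_raise_le Λ ha (by linarith) i h
  refine (h' (2 * (n / 2)) (by omega)).2.trans ?_
  rw [mul_assoc]
  refine mul_le_mul_of_nonneg_left ?_ (by positivity)
  have hn0 : (0 : ℝ) ≤ n := n.cast_nonneg
  have hd : 0 < 2 * (n : ℝ) + a + b + 1 := by linarith
  have h1 := (h' n le_rfl).1
  have h2 := (h' (n - 1) (by omega)).1
  have hu : 0 ≤ ((n : ℝ) + a + b + 1) / (2 * n + a + b + 1) := div_nonneg (by linarith) hd.le
  have hv : 0 ≤ (n : ℝ) / (2 * n + a + b + 1) := div_nonneg hn0 hd.le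
  rw [map_jac_eq_raise Λ n ha hab]
  have hu' := mul_nonneg hu h1
  have hv' := mul_nonneg hv h2
  have hs : 0 < a + b + 3 := by linarith
  rcases Nat.even_or_odd' n with ⟨l, hl | hl⟩
  · rw [show 2 * (n / 2) = n by omega]
    have h5 : 1 ≤ (a + b + 3) * (((n : ℝ) + a + b + 1) / (2 * n + a + b + 1)) := by
      rw [mul_div_assoc', le_div_iff₀ hd]
      nlinarith
    have h6 := mul_le_mul_of_nonneg_right h5 h1
    have h7 := mul_nonneg hs.le hv'
    linarith
  · rw [show 2 * (n / 2) = n - 1 by omega]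
    have h5 : 1 ≤ (a + b + 3) * ((n : ℝ) / (2 * n + a + b + 1)) := by
      have : (1 : ℝ) ≤ n := by exact_mod_cast (by omega : 1 ≤ n)
      rw [mul_div_assoc', le_div_iff₀ hd]
      nlinarith
    have h6 := mul_le_mul_of_nonneg_right h5 h2
    have h7 := mul_nonneg hs.le hu'
    linarith

end Raising

section LowerBounds

open Polynomial

variable (Λ : ℝ[X] →ₗ[ℝ] ℝ)

/-- The functional integrating against a fixed polynomial with respect to a Jacobi weight. -/
noncomputable def testFun (a b : ℝ) (F : ℝ[X]) : ℝ[X] →ₗ[ℝ] ℝ :=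
  (jacFun a b).comp (LinearMap.mulRight ℝ F)

lemma testFun_apply (a b : ℝ) (F q : ℝ[X]) : testFun a b F q = jacFun a b (q * F) := rfl

lemma sum_reflect_le {f : ℕ → ℝ} {N M : ℕ} (hM : M ≤ N + 1) (hf : ∀ k ≤ N, 0 ≤ f k) :
    ∑ m ∈ Finset.range M, f (N - m) ≤ ∑ k ∈ Finset.range (N + 1), f k := by
  rw [← Finset.sum_range_reflect f (N + 1)]
  simp only [Nat.add_sub_cancel]
  exact Finset.sum_le_sum_of_subset_of_nonneg (Finset.range_mono hM)
    fun m _ _ => hf _ (Nat.sub_le _ _)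

lemma sum_conn_le_map_jac {a b σ : ℝ} (ha : -1 < a) (hb : -1 < b) (hσ : 0 ≤ σ)
    (hs : 0 < a + b + σ + 1) {N M : ℕ} (hM : M ≤ N + 1) (hΛ : ∀ k ≤ N, 0 ≤ Λ (jac k a b)) :
    ∑ m ∈ Finset.range M, conn a b σ N (N - m) * Λ (jac (N - m) a b) ≤
      Λ (jac N (a + σ) b) := by
  rw [jac_eq_sum_conn ha hb σ N, map_sum]
  simp only [map_C_mul]
  exact sum_reflect_le (f := fun k => conn a b σ N k * Λ (jac k a b)) hM
    fun k hk => mul_nonneg (conn_nonneg ha hb hσ hs N k) (hΛ k hk)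

lemma sum_conn_le_map_jacAvg {mu c τ : ℝ} (hmu : 0 < mu) (hc : -1 < c - mu) (hτ : 0 ≤ τ)
    (hs : 0 < c + c + τ + 1) {n M : ℕ} (hM : M ≤ n / 2 + 1)
    (hΛ : ∀ k ≤ n / 2, 0 ≤ Λ (jac k (c - mu) (mu - 1 / 2))) :
    ∑ m ∈ Finset.range M, conn c c τ n (2 * (n / 2 - m)) *
        (avgFactor mu c (n / 2 - m) * Λ (jac (n / 2 - m) (c - mu) (mu - 1 / 2))) ≤
      Λ (jacAvg mu (jac n (c + τ) c)) := by
  have hc' : -1 < c := by linarith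
  rw [jac_eq_sum_conn hc' hc' τ n, map_sum, map_sum]
  simp only [← smul_eq_C_mul, map_smul, smul_eq_mul]
  have hterm : ∀ k ≤ n / 2, Λ (jacAvg mu (jac (2 * k) c c)) =
      avgFactor mu c k * Λ (jac k (c - mu) (mu - 1 / 2)) := fun k _ => by
    rw [jacAvg_jac_even hmu hc, map_C_mul]
  have hterm0 : ∀ k ≤ n / 2, 0 ≤ conn c c τ n (2 * k) *
      (avgFactor mu c k * Λ (jac k (c - mu) (mu - 1 / 2))) := fun k hk =>
    mul_nonneg (conn_nonneg hc' hc' hτ hs n _) (mul_nonneg (avgFactor_pos hmu hc k).le (hΛ k hk))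
  refine (sum_reflect_le (f := fun k => conn c c τ n (2 * k) *
      (avgFactor mu c k * Λ (jac k (c - mu) (mu - 1 / 2)))) hM hterm0).trans ?_
  have hinj : Set.InjOn (fun k : ℕ => 2 * k) (Finset.range (n / 2 + 1)) := fun x _ y _ h => by
    simpa using h
  rw [Finset.sum_congr rfl fun k hk => by
      rw [← hterm k (by rw [Finset.mem_range] at hk; omega)],
    ← Finset.sum_image (f := fun k => conn c c τ n k * Λ (jacAvg mu (jac k c c))) hinj]
  refine Finset.sum_le_sum_of_subset_of_nonneg (fun k hk => ?_) fun k hk _ => ?_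
  · simp only [Finset.mem_image, Finset.mem_range] at hk ⊢
    omega
  · rw [Finset.mem_range] at hk
    rcases Nat.even_or_odd k with h | h
    · obtain ⟨l, rfl⟩ := h.two_dvd
      rw [hterm l (by omega)]
      exact hterm0 l (by omega)
    · rw [jacAvg_jac_odd mu hc' h, map_zero, mul_zero]

lemma exists_le_rho_mul_rho {τ κ : ℝ} (hτ : 0 < τ) (hκ : 0 < κ) (h : τ + κ = 1) :
    ∃ c > 0, ∀ m j : ℕ, m ≤ j → j ≤ 2 * m + 1 → c * ((m : ℝ) + 1)⁻¹ ≤ rho τ j * rho κ m := by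
  obtain ⟨c₁, hc₁, h₁⟩ := exists_le_of_isTheta (rho_isTheta hτ)
    (fun n => (rho_pos hτ n).le) (fun n => by positivity)
  obtain ⟨c₂, hc₂, h₂⟩ := exists_le_of_isTheta (rho_isTheta hκ)
    (fun n => (rho_pos hκ n).le) (fun n => by positivity)
  refine ⟨c₁ * (4 ^ |τ - 1|)⁻¹ * c₂, by positivity, fun m j hm hj => ?_⟩
  have hm' : (m : ℝ) ≤ j := by exact_mod_cast hm
  have hj' : (j : ℝ) ≤ 2 * m + 1 := by exact_mod_cast hj
  have hm0 : (0 : ℝ) ≤ m := m.cast_nonneg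
  have hmp : (0 : ℝ) < m + 1 := by linarith
  have k := rpow_le_of_comparable hmp (show (0 : ℝ) < j + 1 by linarith) (by linarith)
    (by linarith) (τ - 1)
  set D : ℝ := 4 ^ |τ - 1|
  have hD : 0 < D := by positivity
  have hinv : ((m : ℝ) + 1)⁻¹ = ((m : ℝ) + 1) ^ (τ - 1) * ((m : ℝ) + 1) ^ (κ - 1) := by
    rw [← Real.rpow_add hmp, show τ - 1 + (κ - 1) = -1 by linarith, Real.rpow_neg_one]
  have k1 : c₁ * (D⁻¹ * ((m : ℝ) + 1) ^ (τ - 1)) ≤ rho τ j := by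
    refine le_trans (mul_le_mul_of_nonneg_left ?_ hc₁.le) (h₁ j)
    rw [inv_mul_le_iff₀ hD]
    exact k
  calc c₁ * D⁻¹ * c₂ * ((m : ℝ) + 1)⁻¹
      = c₁ * (D⁻¹ * ((m : ℝ) + 1) ^ (τ - 1)) * (c₂ * ((m : ℝ) + 1) ^ (κ - 1)) := by
        rw [hinv]
        ring
    _ ≤ _ := mul_le_mul k1 (h₂ m) (by positivity) (rho_pos hτ j).le

lemma half_log_le_sum (n : ℕ) (hn : 2 ≤ n) :
    1 / 2 * Real.log n ≤ ∑ m ∈ Finset.range (n / 2 / 2 + 1), ((m : ℝ) + 1)⁻¹ := by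
  have h := log_add_one_le_harmonic (n / 2 / 2 + 1)
  have e : ((harmonic (n / 2 / 2 + 1) : ℚ) : ℝ) =
      ∑ m ∈ Finset.range (n / 2 / 2 + 1), ((m : ℝ) + 1)⁻¹ := by
    simp [harmonic]
  rw [e] at h
  refine le_trans ?_ h
  have h1 : (n : ℝ) ≤ (((n / 2 / 2 + 1 : ℕ) : ℝ) + 1) ^ 2 := by
    have h2 : n ≤ (n / 2 / 2 + 1 + 1) ^ 2 := by
      have h3 : n ≤ 4 * (n / 2 / 2) + 3 := by omega
      generalize n / 2 / 2 = q at h3 ⊢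
      nlinarith
    exact_mod_cast h2
  have hn0 : (0 : ℝ) < n := by exact_mod_cast (by omega : 0 < n)
  have h3 := Real.log_le_log hn0 h1
  rw [Real.log_pow] at h3
  push_cast at h3 ⊢
  linarith

lemma mul_rpow_le_rpow {x y : ℝ} (hx : 0 < x) (hy : 0 < y) (h1 : x ≤ 4 * y) (h2 : y ≤ 4 * x)
    (e : ℝ) : (4 ^ |e|)⁻¹ * x ^ e ≤ y ^ e := by
  rw [inv_mul_le_iff₀ (by positivity)]
  exact rpow_le_of_comparable hx hy h1 h2 e

end LowerBounds

section Moments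

open Polynomial

lemma exists_le_conn_even {c τ : ℝ} (hc : -1 < c) (hcc : 0 < c + c + 1) (hτ : 0 ≤ τ) :
    ∃ d > 0, ∀ n m : ℕ, m ≤ n / 2 / 2 →
      d * (rho τ (n - 2 * (n / 2 - m)) * (((n / 2 : ℕ) : ℝ) + 1) ^ (-τ)) ≤
        conn c c τ n (2 * (n / 2 - m)) := by
  obtain ⟨d, hd, h⟩ := exists_le_conn hc hc hcc hτ
  refine ⟨d * (4 ^ |-τ|)⁻¹, by positivity, fun n m hm => ?_⟩
  have k := h (2 * (n / 2 - m)) (n - 2 * (n / 2 - m)) (by omega)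
  rw [show 2 * (n / 2 - m) + (n - 2 * (n / 2 - m)) = n by omega, ← Nat.cast_add,
    show 2 * (n / 2 - m) + (n - 2 * (n / 2 - m)) = n by omega] at k
  refine le_trans ?_ k
  have e1 : (((n / 2 : ℕ) : ℝ) + 1) ≤ 4 * (n + 1) := by
    exact_mod_cast (by omega : n / 2 + 1 ≤ 4 * (n + 1))
  have e2 : (n : ℝ) + 1 ≤ 4 * (((n / 2 : ℕ) : ℝ) + 1) := by
    exact_mod_cast (by omega : n + 1 ≤ 4 * (n / 2 + 1))
  have k2 := mul_rpow_le_rpow (by positivity) (by positivity) e1 e2 (-τ)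
  rw [mul_assoc, mul_left_comm (4 ^ |-τ|)⁻¹]
  exact mul_le_mul_of_nonneg_left (mul_le_mul_of_nonneg_left k2 (rho_nonneg hτ _)) hd.le

lemma exists_le_avgFactor_sub {mu c : ℝ} (hmu : 0 < mu) (hc : -1 < c - mu) :
    ∃ d > 0, ∀ N m : ℕ, m ≤ N / 2 →
      d * ((N : ℝ) + 1) ^ (-2 * mu) ≤ avgFactor mu c (N - m) := by
  obtain ⟨d, hd, h⟩ := exists_le_avgFactor hmu hc
  refine ⟨d * (4 ^ |-2 * mu|)⁻¹, by positivity, fun N m hm => le_trans ?_ (h (N - m))⟩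
  have e1 : (N : ℝ) + 1 ≤ 4 * (((N - m : ℕ) : ℝ) + 1) := by
    exact_mod_cast (by omega : N + 1 ≤ 4 * (N - m + 1))
  have e2 : ((N - m : ℕ) : ℝ) + 1 ≤ 4 * ((N : ℝ) + 1) := by
    exact_mod_cast (by omega : N - m + 1 ≤ 4 * (N + 1))
  rw [mul_assoc]
  exact mul_le_mul_of_nonneg_left
    (mul_rpow_le_rpow (by positivity) (by positivity) e1 e2 _) hd.le

lemma exists_le_testFun {a b σ : ℝ} (ha : -1 < a) (hb : -1 < b) (hσ : 0 ≤ σ)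
    (hs : 0 < a + b + σ + 1) :
    ∃ c > 0, ∀ N m : ℕ, m ≤ N → c * (rho σ m * ((N : ℝ) + 1) ^ (-2 * a - σ - 1)) ≤
      testFun a b (jac N (a + σ) b) (jac (N - m) a b) := by
  obtain ⟨c, hc, h⟩ := exists_le_jacFun_jac_mul_jac ha hb (σ := σ) (by linarith) hs
  refine ⟨c, hc, fun N m hm => ?_⟩
  have k := h (N - m) m (rho_nonneg hσ m)
  rw [← Nat.cast_add, Nat.sub_add_cancel hm] at k
  rwa [testFun_apply, mul_comm (jac _ _ _)]

lemma testFun_jac_nonneg {a b σ : ℝ} (ha : -1 < a) (hb : -1 < b) (hσ : 0 ≤ σ)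
    (hs : 0 < a + b + σ + 1) (N k : ℕ) : 0 ≤ testFun a b (jac N (a + σ) b) (jac k a b) := by
  rw [testFun_apply, mul_comm]
  exact jacFun_jac_mul_jac_nonneg ha hb hσ hs N k

/-- The moment bound in the subcritical case `δ < λ`. -/
lemma exists_le_moment_of_lt {lam mu δ : ℝ} (hlam : 0 ≤ lam) (hmu : 0 < mu) (hδ : -1 < δ)
    (i : ℕ) :
    ∃ c : ℝ, 0 < c ∧ ∀ n : ℕ, 2 ≤ n →
      c * (((n / 2 : ℕ) : ℝ) + 1) ^
        (-mu - 1 - (lam + mu + δ + 1 / 2) - (2 * lam + 3 / 2)) ≤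
      jacFun (lam - 1 / 2 + (lam + 2)) (mu - 1 / 2 + i)
        (jacAvg mu (jac n (lam + mu + δ + 1 / 2) (lam + mu - 1 + 1 / 2)) *
          jac (n / 2) (2 * lam + 3 / 2) (mu - 1 / 2 + i)) := by
  have hi0 : (0 : ℝ) ≤ i := i.cast_nonneg
  set b := mu - 1 / 2 + (i : ℝ) with hbdef
  set a := 2 * lam + 3 / 2 with hadef
  set c := lam + mu - 1 / 2 with hcdef
  rw [show lam - 1 / 2 + (lam + 2) = a by ring, show lam + mu - 1 + 1 / 2 = c by ring,
    show lam + mu + δ + 1 / 2 = c + (δ + 1) by ring]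
  have hca : c - mu = a + -(lam + 2) := by ring
  obtain ⟨c₁, hc₁, h₁⟩ := exists_le_jacFun_jac_mul_jac (a := a) (b := b) (σ := -(lam + 2))
    (by linarith) (by linarith) (by linarith) (by linarith)
  obtain ⟨c₂, hc₂, h₂⟩ := exists_le_conn_even (c := c) (τ := δ + 1) (by linarith) (by linarith)
    (by linarith)
  obtain ⟨c₃, hc₃, h₃⟩ := exists_le_avgFactor_sub (c := c) hmu (by linarith)
  refine ⟨c₂ * min 1 (δ + 1) * (c₃ * ((2 ^ i)⁻¹ * c₁)),
    mul_pos (mul_pos hc₂ (lt_min one_pos (by linarith))) (by positivity), fun n _ => ?_⟩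
  rw [← testFun_apply]
  set N := n / 2
  set X : ℝ := (N : ℝ) + 1
  have hX : 0 < X := by positivity
  set Λ := testFun a b (jac N a b)
  have hΛ : ∀ k ≤ N, 0 ≤ Λ (jac k (c - mu) (mu - 1 / 2 + i)) := fun k hk => by
    rw [hca]
    rcases hk.lt_or_eq with hk | hk
    · exact (jacFun_jac_mul_jac_eq_zero hk (by linarith) (by linarith) (by linarith)).ge
    · have h := h₁ N 0 (by rw [rho_zero]; exact zero_le_one)
      rw [rho_zero] at h
      rw [hk]
      exact le_trans (by positivity) h
  have hraise := map_jac_raise_le Λ (by linarith) (by linarith) i hΛ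
  have hmain := sum_conn_le_map_jacAvg Λ hmu (c := c) (τ := δ + 1) (by linarith)
    (by linarith) (by linarith) (n := n) (M := 1) (by omega) fun k hk => (hraise k hk).1
  rw [Finset.sum_range_one, Nat.sub_zero] at hmain
  refine le_trans ?_ hmain
  have k1 := h₁ N 0 (by rw [rho_zero]; exact zero_le_one)
  have k2 := h₂ n 0 (Nat.zero_le _)
  have k3 := h₃ N 0 (Nat.zero_le _)
  have k4 := (hraise N le_rfl).2
  rw [← hbdef, hca] at k4
  rw [← hca] at k4
  simp only [rho_zero, one_mul, Nat.cast_zero, add_zero] at k1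
  rw [Nat.sub_zero] at k2 k3
  have hrho : min 1 (δ + 1) ≤ rho (δ + 1) (n - 2 * N) := by
    rcases (by omega : n - 2 * N = 0 ∨ n - 2 * N = 1) with e | e
    · rw [e, rho_zero]; exact min_le_left _ _
    · rw [e, rho, rise, Finset.prod_range_one]; simp
  have hmin : 0 < min 1 (δ + 1) := lt_min one_pos (by linarith)
  have k5 : c₂ * min 1 (δ + 1) * X ^ (-(δ + 1)) ≤ conn c c (δ + 1) n (2 * N) := by
    refine le_trans ?_ k2
    rw [mul_assoc]
    exact mul_le_mul_of_nonneg_left (mul_le_mul_of_nonneg_right hrho (by positivity)) hc₂.le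
  have k6 : (2 ^ i)⁻¹ * c₁ * X ^ (-2 * a - -(lam + 2) - 1) ≤
      Λ (jac N (c - mu) (mu - 1 / 2)) := by
    rw [mul_assoc, inv_mul_le_iff₀ (by positivity)]
    refine le_trans ?_ k4
    rw [hca]
    exact k1
  calc _ = c₂ * min 1 (δ + 1) * X ^ (-(δ + 1)) * (c₃ * X ^ (-2 * mu) *
        ((2 ^ i)⁻¹ * c₁ * X ^ (-2 * a - -(lam + 2) - 1))) := by
        rw [show -mu - 1 - (c + (δ + 1)) - a =
          -(δ + 1) + (-2 * mu + (-2 * a - -(lam + 2) - 1)) by rw [hcdef, hadef]; ring,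
          Real.rpow_add hX, Real.rpow_add hX]
        ring
    _ ≤ _ := by
        refine mul_le_mul k5 (mul_le_mul k3 k6 (by positivity) ?_) (by positivity) ?_
        · exact le_trans (by positivity) k3
        · exact le_trans (by positivity) k5

/-- The moment bound in the critical case `δ = λ` for non-integral `λ`, with `P = ⌊λ⌋ + 1`. -/
lemma exists_le_moment_of_lt_natCast {lam mu : ℝ} (hlam : 0 ≤ lam) (hmu : 0 < mu) {P : ℕ}
    (hP : lam < P) (hP' : (P : ℝ) < lam + 1) (i : ℕ) :
    ∃ c : ℝ, 0 < c ∧ ∀ n : ℕ, 2 ≤ n →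
      c * (((n / 2 : ℕ) : ℝ) + 1) ^
        (-mu - 1 - (lam + mu + lam + 1 / 2) - (2 * P - 1 / 2)) * Real.log n ≤
      jacFun (lam - 1 / 2 + P) (mu - 1 / 2 + i)
        (jacAvg mu (jac n (lam + mu + lam + 1 / 2) (lam + mu - 1 + 1 / 2)) *
          jac (n / 2) (2 * P - 1 / 2) (mu - 1 / 2 + i)) := by
  have hi0 : (0 : ℝ) ≤ i := i.cast_nonneg
  set b := mu - 1 / 2 + (i : ℝ) with hbdef
  set a := lam - 1 / 2 + (P : ℝ) with hadef
  set κ := (P : ℝ) - lam with hκdef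
  set B := lam + mu - 1 / 2 with hBdef
  set c := B + P with hcdef
  set τ := 1 - κ with hτdef
  have hκ : 0 < κ := by linarith
  have hτ : 0 < τ := by linarith
  rw [show 2 * (P : ℝ) - 1 / 2 = a + κ by ring, show lam + mu - 1 + 1 / 2 = B by ring,
    show lam + mu + lam + 1 / 2 = c + τ by ring]
  have hca : c - mu = a := by ring
  obtain ⟨c₁, hc₁, h₁⟩ := exists_le_testFun (a := a) (b := b) (σ := κ)
    (by linarith) (by linarith) (by linarith) (by linarith)
  obtain ⟨c₂, hc₂, h₂⟩ := exists_le_conn_even (c := c) (τ := τ) (by linarith) (by linarith)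
    (by linarith)
  obtain ⟨c₃, hc₃, h₃⟩ := exists_le_avgFactor_sub (c := c) hmu (by linarith)
  obtain ⟨c₄, hc₄, h₄⟩ := exists_le_rho_mul_rho hτ hκ (by linarith)
  refine ⟨(2 ^ P)⁻¹ * (c₂ * c₃ * ((2 ^ i)⁻¹ * c₁) * c₄ * (1 / 2)), by positivity, fun n hn => ?_⟩
  rw [← testFun_apply]
  set N := n / 2 with hN
  set X : ℝ := (N : ℝ) + 1
  have hX : 0 < X := by positivity
  set Λ := testFun a b (jac N (a + κ) b)
  have hraise : ∀ N' : ℕ, ∀ k ≤ N', 0 ≤ Λ (jac k (c - mu) (mu - 1 / 2)) ∧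
      Λ (jac k (c - mu) b) ≤ 2 ^ i * Λ (jac k (c - mu) (mu - 1 / 2)) := fun N' =>
    map_jac_raise_le Λ (by linarith) (by linarith) i fun k _ => by
      rw [hca]
      exact testFun_jac_nonneg (by linarith) (by linarith) hκ.le (by linarith) N k
  have hnonneg : ∀ k ≤ n, 0 ≤ (Λ ∘ₗ jacAvg mu) (jac k (c + τ) (B + P)) := fun k _ => by
    have := sum_conn_le_map_jacAvg Λ hmu (c := c) (τ := τ) (by linarith)
      (by linarith) (by linarith) (n := k) (M := 0) (by omega) fun l hl => (hraise _ l hl).1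
    simpa using this
  have hB := (map_jac_raise_le (Λ ∘ₗ jacAvg mu) (by linarith) (by linarith) P hnonneg n le_rfl).2
  rw [← inv_mul_le_iff₀ (by positivity)] at hB
  refine le_trans ?_ hB
  rw [mul_assoc, mul_assoc]
  refine mul_le_mul_of_nonneg_left ?_ (by positivity)
  have hmain := sum_conn_le_map_jacAvg Λ hmu (c := c) (τ := τ) (by linarith)
    (by linarith) (by linarith) (n := n) (M := N / 2 + 1) (by omega) fun k hk => (hraise _ k hk).1
  refine le_trans ?_ hmain
  have hterm : ∀ m ∈ Finset.range (N / 2 + 1),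
      c₂ * c₃ * ((2 ^ i)⁻¹ * c₁) * c₄ * X ^ (-mu - 1 - (c + τ) - (a + κ)) * ((m : ℝ) + 1)⁻¹ ≤
      conn c c τ n (2 * (n / 2 - m)) *
        (avgFactor mu c (n / 2 - m) * Λ (jac (n / 2 - m) (c - mu) (mu - 1 / 2))) := by
    intro m hm
    have hm' : m ≤ N / 2 := by rw [Finset.mem_range] at hm; omega
    have k1 := h₁ N m (by omega)
    have k2 := h₂ n m hm'
    have k3 := h₃ N m hm'
    have k4 := (hraise _ (N - m) le_rfl).2
    have k5 := h₄ m (n - 2 * (N - m)) (by omega) (by omega)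
    rw [← hN] at k2 ⊢
    have hr1 := rho_pos hκ m
    have hr2 := rho_pos hτ (n - 2 * (N - m))
    set r1 := rho κ m
    set r2 := rho τ (n - 2 * (N - m))
    have k6 : (2 ^ i)⁻¹ * (c₁ * (r1 * X ^ (-2 * a - κ - 1))) ≤
        Λ (jac (N - m) (c - mu) (mu - 1 / 2)) := by
      rw [inv_mul_le_iff₀ (by positivity)]
      refine le_trans ?_ k4
      rw [hca]
      exact k1
    calc _ = c₂ * c₃ * ((2 ^ i)⁻¹ * c₁) *
          (X ^ (-τ) * X ^ (-2 * mu) * X ^ (-2 * a - κ - 1)) * (c₄ * ((m : ℝ) + 1)⁻¹) := by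
          rw [show -mu - 1 - (c + τ) - (a + κ) =
            -τ + -2 * mu + (-2 * a - κ - 1) by linarith, Real.rpow_add hX, Real.rpow_add hX]
          ring
      _ ≤ c₂ * c₃ * ((2 ^ i)⁻¹ * c₁) *
          (X ^ (-τ) * X ^ (-2 * mu) * X ^ (-2 * a - κ - 1)) * (r2 * r1) :=
          mul_le_mul_of_nonneg_left k5 (by positivity)
      _ = c₂ * (r2 * X ^ (-τ)) * (c₃ * X ^ (-2 * mu) *
          ((2 ^ i)⁻¹ * (c₁ * (r1 * X ^ (-2 * a - κ - 1))))) := by ring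
      _ ≤ _ := by
          refine mul_le_mul k2 (mul_le_mul k3 k6 (by positivity) ?_) (by positivity) ?_
          · exact le_trans (by positivity) k3
          · exact le_trans (by positivity) k2
  refine le_trans ?_ (Finset.sum_le_sum hterm)
  rw [← Finset.mul_sum]
  refine le_trans (le_of_eq ?_) (mul_le_mul_of_nonneg_left (half_log_le_sum n hn) (by positivity))
  ring

/-- The moment bound in the critical case `δ = λ` for integral `λ`. -/
lemma exists_le_moment_of_eq_natCast {lam mu : ℝ} (hmu : 0 < mu) {l : ℕ}
    (hl : lam = l) (i : ℕ) :
    ∃ c : ℝ, 0 < c ∧ ∀ n : ℕ, 2 ≤ n →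
      c * (((n / 2 : ℕ) : ℝ) + 1) ^
        (-mu - 1 - (lam + mu + lam + 1 / 2) - (2 * lam + 1)) * Real.log n ≤
      jacFun (lam - 1 / 2 + (lam + 3 / 4)) (mu - 1 / 2 + i)
        (jacAvg mu (jac n (lam + mu + lam + 1 / 2) (lam + mu - 1 + 1 / 2)) *
          jac (n / 2) (2 * lam + 1) (mu - 1 / 2 + i)) := by
  have hlam : 0 ≤ lam := hl ▸ l.cast_nonneg
  have hi0 : (0 : ℝ) ≤ i := i.cast_nonneg
  set b := mu - 1 / 2 + (i : ℝ) with hbdef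
  set a := 2 * lam + 1 / 4 with hadef
  set B := lam + mu - 1 / 2 with hBdef
  set c := lam + mu + lam + 1 / 2 with hcdef
  have hcB : B + ((l + 1 : ℕ) : ℝ) = c := by push_cast; rw [← hl]; ring
  rw [show 2 * lam + 1 = a + 3 / 4 by ring, show lam + mu - 1 + 1 / 2 = B by ring,
    show lam - 1 / 2 + (lam + 3 / 4) = a by ring]
  have hca : c - mu = a + 1 / 4 := by ring
  obtain ⟨c₁, hc₁, h₁⟩ := exists_le_testFun (a := a) (b := b) (σ := 3 / 4)
    (by linarith) (by linarith) (by norm_num) (by linarith)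
  obtain ⟨c₂, hc₂, h₂⟩ := exists_le_conn (a := a) (b := b) (σ := 1 / 4) (by linarith)
    (by linarith) (by linarith) (by norm_num)
  obtain ⟨c₃, hc₃, h₃⟩ := exists_le_avgFactor_sub (c := c) hmu (by linarith)
  obtain ⟨c₄, hc₄, h₄⟩ := exists_le_rho_mul_rho (τ := 1 / 4) (κ := 3 / 4) (by norm_num)
    (by norm_num) (by norm_num)
  have hs : 0 < c + B + 3 := by linarith
  refine ⟨(2 ^ l * (c + B + 3))⁻¹ * (c₃ * ((2 ^ i)⁻¹ * (c₂ * c₁ * c₄ * (1 / 2)))),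
    by positivity, fun n hn => ?_⟩
  rw [← testFun_apply]
  set N := n / 2 with hN
  set X : ℝ := (N : ℝ) + 1
  have hX : 0 < X := by positivity
  set Λ := testFun a b (jac N (a + 3 / 4) b)
  have htest : ∀ k, 0 ≤ Λ (jac k a b) :=
    testFun_jac_nonneg (by linarith) (by linarith) (by norm_num) (by linarith) N
  have hΛ : ∀ k, 0 ≤ Λ (jac k (c - mu) b) := fun k => by
    have := sum_conn_le_map_jac Λ (a := a) (b := b) (σ := 1 / 4) (N := k) (M := 0) (by linarith)
      (by linarith) (by norm_num) (by linarith) (by omega) fun j _ => htest j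
    rw [hca]
    simpa using this
  have hraise : ∀ k, 0 ≤ Λ (jac k (c - mu) (mu - 1 / 2)) ∧
      Λ (jac k (c - mu) b) ≤ 2 ^ i * Λ (jac k (c - mu) (mu - 1 / 2)) := fun k =>
    map_jac_raise_le Λ (by linarith) (by linarith) i (fun k _ => hΛ k) k le_rfl
  have hnonneg : ∀ k ≤ n, 0 ≤ (Λ ∘ₗ jacAvg mu) (jac k c (B + (l + 1 : ℕ))) := fun k _ => by
    have := sum_conn_le_map_jacAvg Λ hmu (c := c) (τ := 0) (by linarith)
      le_rfl (by linarith) (n := k) (M := 0) (by omega) fun j _ => (hraise j).1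
    rw [hcB]
    simpa using this
  have hB := map_jac_even_raise_le (Λ ∘ₗ jacAvg mu) (by linarith) (by linarith) l hnonneg
  rw [← inv_mul_le_iff₀ (by positivity), hcB, LinearMap.comp_apply, LinearMap.comp_apply,
    ← hN, jacAvg_jac_even hmu (by linarith), map_C_mul] at hB
  refine le_trans ?_ hB
  rw [mul_assoc, mul_assoc]
  refine mul_le_mul_of_nonneg_left ?_ (by positivity)
  have hmain := sum_conn_le_map_jac Λ (a := a) (b := b) (σ := 1 / 4) (N := N) (M := N / 2 + 1)
    (by linarith) (by linarith) (by norm_num) (by linarith) (by omega) fun j _ => htest j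
  rw [← hca] at hmain
  have hterm : ∀ m ∈ Finset.range (N / 2 + 1),
      c₂ * c₁ * c₄ * X ^ (-2 * a - 2) * ((m : ℝ) + 1)⁻¹ ≤
      conn a b (1 / 4) N (N - m) * Λ (jac (N - m) a b) := by
    intro m hm
    have hm' : m ≤ N / 2 := by rw [Finset.mem_range] at hm; omega
    have k1 := h₁ N m (by omega)
    have k2 := h₂ (N - m) m (by omega)
    have k5 := h₄ m m le_rfl (by omega)
    rw [← Nat.cast_add, Nat.sub_add_cancel (by omega)] at k2
    have hr1 := rho_pos (show (0 : ℝ) < 3 / 4 by norm_num) m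
    have hr2 := rho_pos (show (0 : ℝ) < 1 / 4 by norm_num) m
    set r1 := rho (3 / 4) m
    set r2 := rho (1 / 4) m
    calc _ = c₂ * c₁ * (X ^ (-(1 / 4 : ℝ)) * X ^ (-2 * a - 3 / 4 - 1)) *
          (c₄ * ((m : ℝ) + 1)⁻¹) := by
          rw [← Real.rpow_add hX, show -(1 / 4 : ℝ) + (-2 * a - 3 / 4 - 1) = -2 * a - 2 by ring]
          ring
      _ ≤ c₂ * c₁ * (X ^ (-(1 / 4 : ℝ)) * X ^ (-2 * a - 3 / 4 - 1)) * (r2 * r1) :=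
          mul_le_mul_of_nonneg_left k5 (by positivity)
      _ = c₂ * (r2 * X ^ (-(1 / 4 : ℝ))) * (c₁ * (r1 * X ^ (-2 * a - 3 / 4 - 1))) := by ring
      _ ≤ _ := mul_le_mul k2 k1 (by positivity) (le_trans (by positivity) k2)
  have hsum := (Finset.sum_le_sum hterm).trans hmain
  rw [← Finset.mul_sum] at hsum
  have k3 := h₃ N 0 (Nat.zero_le _)
  rw [Nat.sub_zero] at k3
  have hlog := mul_le_mul_of_nonneg_left (half_log_le_sum n hn)
    (show 0 ≤ c₂ * c₁ * c₄ * X ^ (-2 * a - 2) by positivity)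
  have hlog0 : 0 ≤ Real.log n := Real.log_natCast_nonneg n
  calc _ = c₃ * X ^ (-2 * mu) * ((2 ^ i)⁻¹ *
        (c₂ * c₁ * c₄ * X ^ (-2 * a - 2) * (1 / 2 * Real.log n))) := by
        rw [show -mu - 1 - c - (a + 3 / 4) = -2 * mu + (-2 * a - 2) by linarith,
          Real.rpow_add hX]
        ring
    _ ≤ _ := by
        refine mul_le_mul k3 ?_ (by positivity) (avgFactor_pos hmu (by linarith) N).le
        rw [inv_mul_le_iff₀ (by positivity)]
        exact (hlog.trans hsum).trans (hraise N).2

end Moments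

/-- Proposition 4.1: for `λ ≥ 0`, `μ > 0`, `-1 < δ ≤ λ`, with
`a = λ+μ+δ`, `b = λ+μ-1`, there is `c > 0` such that for all `n ≥ 2`,
`∫_0^1 |∫_{-1}^1 P_n^{(a+1/2,b+1/2)}(ty)(1-t²)^{μ-1} dt| |y|^{2μ}(1-y²)^{λ-1/2} dy
  ≥ c n^{-μ-1/2} L_n`, where `L_n = log n` if `δ = λ` and `L_n = 1` otherwise. -/
theorem lower_bound_double_jacobi_integral (lam mu δ : ℝ) (hlam : 0 ≤ lam) (hmu : 0 < mu)
    (hδ1 : -1 < δ) (hδ2 : δ ≤ lam) :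
    ∃ c : ℝ, 0 < c ∧ ∀ n : ℕ, 2 ≤ n →
      c * (n : ℝ) ^ (-mu - 1 / 2) * (if δ = lam then Real.log n else 1) ≤
        ∫ y in (0 : ℝ)..1,
          |∫ t in (-1 : ℝ)..1,
              jacobiP n (lam + mu + δ + 1 / 2) (lam + mu - 1 + 1 / 2) (t * y) *
                (1 - t ^ 2) ^ (mu - 1)| *
            (|y| ^ (2 * mu) * (1 - y ^ 2) ^ (lam - 1 / 2)) := by
  obtain ⟨i, hmi⟩ := exists_nat_ge mu
  have hi : 1 ≤ i := by
    have : (0 : ℝ) < i := hmu.trans_le hmi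
    exact_mod_cast this
  have hA : -1 < lam + mu + δ + 1 / 2 := by linarith
  split_ifs with hδ
  · subst hδ
    have hL : ∀ n : ℕ, 2 ≤ n → 0 ≤ Real.log n := fun n _ => Real.log_natCast_nonneg n
    have hfloor := Nat.lt_floor_add_one δ
    rcases (Nat.floor_le hlam).eq_or_lt with h | h
    · exact exists_le_integral_of_moment _ hlam hmu hA (by linarith) (by linarith) hi hmi hL
        (exists_le_moment_of_eq_natCast hmu h.symm i)
    · have hP : δ < ((⌊δ⌋₊ + 1 : ℕ) : ℝ) := by push_cast; exact hfloor
      have hP1 : (1 : ℝ) ≤ ((⌊δ⌋₊ + 1 : ℕ) : ℝ) := by exact_mod_cast Nat.le_add_left 1 _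
      exact exists_le_integral_of_moment _ hlam hmu hA (by linarith) (by linarith) hi hmi hL
        (exists_le_moment_of_lt_natCast hlam hmu hP (by push_cast; linarith) i)
  · refine exists_le_integral_of_moment (L := fun _ => 1) (p := lam + 2) (a := 2 * lam + 3 / 2)
      _ hlam hmu hA (by linarith) (by linarith) hi hmi (fun _ _ => zero_le_one) ?_
    simpa only [mul_one] using exists_le_moment_of_lt hlam hmu hδ1 i
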